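/- Let p ≥ 5 be a prime and let w be an integer whose residue class generates the multiplicative group of units modulo p (a primitive root mod p). Let M be the Lie ring ⟨a, b | [b,a,b] − [b,a,a,a] − w•[b,a,a,a,a,a], [b,a,a,a,b] − [b,a,a,a,a,a], p•a, p•b, class 6⟩, i.e., the quotient of the free Lie ring on generators a, b by the Lie ideal generated by the listed elements together with the 7th term of the lower central series. Then the number of isomorphism classes of Lie rings L of cardinality p^8, nilpotent of class exactly 7, with L/L⁷ ≅ M equals p³ − (p² − p)/2. -/

import Mathlib

/-- An isomorphism between two Lie rings (Lie algebras over `ℤ`) exists. -/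
def IsLieIso (α β : Type*) [LieRing α] [LieRing β] : Prop :=
  ∃ e : α ≃ β, (∀ x y, e (x + y) = e x + e y) ∧ (∀ x y, e ⁅x, y⁆ = ⁅e x, e y⁆)

/-- A Lie ring is nilpotent of class exactly `c`: `L^{c+1} = 0` and `L^c ≠ 0`. -/
def LieClassEq (α : Type*) [LieRing α] (c : ℕ) : Prop :=
  LieModule.lowerCentralSeries ℤ α α c = ⊥ ∧ LieModule.lowerCentralSeries ℤ α α (c - 1) ≠ ⊥

/-- The free Lie ring on two generators. -/
abbrev FL : Type := FreeLieAlgebra ℤ (Fin 2)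

/-- The generator `a`. -/
noncomputable def ga : FL := FreeLieAlgebra.of ℤ 0
/-- The generator `b`. -/
noncomputable def gb : FL := FreeLieAlgebra.of ℤ 1
/-- The left-normed bracket `[b,a,b]`. -/
noncomputable def bab : FL := ⁅⁅gb, ga⁆, gb⁆
/-- The left-normed bracket `[b,a,a,a]`. -/
noncomputable def ba3 : FL := ⁅⁅⁅gb, ga⁆, ga⁆, ga⁆
/-- The left-normed bracket `[b,a,a,a,b]`. -/
noncomputable def ba3b : FL := ⁅ba3, gb⁆
/-- The left-normed bracket `[b,a,a,a,a]`. -/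
noncomputable def ba4 : FL := ⁅ba3, ga⁆
/-- The left-normed bracket `[b,a,a,a,a,a]`. -/
noncomputable def ba5 : FL := ⁅ba4, ga⁆

/-- The quotient of the free Lie ring on `a, b` by the Lie ideal generated by the
given relator set together with `p•a`, `p•b` and the 7th term of the lower central
series (i.e. the presentation is of class at most 6). -/
abbrev presLie (p : ℕ) (rels : Set FL) : Type :=
  FL ⧸ (LieSubmodule.lieSpan ℤ FL (rels ∪ {p • ga, p • gb}) ⊔
    LieModule.lowerCentralSeries ℤ FL FL 6)

/-- `s` is a Lie ring structure of maximal class 7 on a set of size `p^8` whose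
quotient by the 7th term of the lower central series is isomorphic to `β`. -/
def IsMaxClassDescendantOf (p : ℕ) (β : Type*) [LieRing β]
    (s : LieRing (Fin (p ^ 8))) : Prop := by
  letI := s
  exact LieClassEq (Fin (p ^ 8)) 7 ∧
    IsLieIso (Fin (p ^ 8) ⧸ LieModule.lowerCentralSeries ℤ (Fin (p ^ 8)) (Fin (p ^ 8)) 6) β

/-- The integral form of the descendants: the free abelian group on `a, b, c₂, …, c₇`, where
`c₂ = [b,a]` and `cᵢ₊₁ = [cᵢ,a]`. Its bracket satisfies `[c₂,b] = c₄ + w c₆ + k c₇` and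
`[c₄,b] = c₆ + l c₇`. -/
def Cover (_w _k _l : ℤ) : Type := Fin 8 → ℤ

namespace Cover

variable {w k l : ℤ}

instance : AddCommGroup (Cover w k l) := inferInstanceAs (AddCommGroup (Fin 8 → ℤ))

@[simp] lemma add_apply (x y : Cover w k l) (i : Fin 8) : (x + y) i = x i + y i := rfl
@[simp] lemma zero_apply (i : Fin 8) : (0 : Cover w k l) i = 0 := rfl
@[simp] lemma neg_apply (x : Cover w k l) (i : Fin 8) : (-x) i = -x i := rfl
@[simp] lemma sub_apply (x y : Cover w k l) (i : Fin 8) : (x - y) i = x i - y i := rfl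
@[simp] lemma zsmul_apply (n : ℤ) (x : Cover w k l) (i : Fin 8) : (n • x) i = n * x i := rfl
@[simp] lemma nsmul_apply (n : ℕ) (x : Cover w k l) (i : Fin 8) : (n • x) i = n * x i := by
  rw [← natCast_zsmul, zsmul_apply]

/-- The element with the given coordinates. -/
def of (v : Fin 8 → ℤ) : Cover w k l := v

@[simp] lemma of_apply (v : Fin 8 → ℤ) (i : Fin 8) : (of v : Cover w k l) i = v i := rfl

lemma ext8 {x y : Cover w k l} (h0 : x 0 = y 0) (h1 : x 1 = y 1) (h2 : x 2 = y 2)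
    (h3 : x 3 = y 3) (h4 : x 4 = y 4) (h5 : x 5 = y 5) (h6 : x 6 = y 6) (h7 : x 7 = y 7) :
    x = y := by
  funext i
  fin_cases i <;> assumption

instance : Bracket (Cover w k l) (Cover w k l) where
  bracket x y := of ![0, 0,
    x 1 * y 0 - x 0 * y 1,
    x 2 * y 0 - x 0 * y 2,
    x 3 * y 0 - x 0 * y 3 + (x 2 * y 1 - x 1 * y 2),
    x 4 * y 0 - x 0 * y 4 + (x 3 * y 1 - x 1 * y 3),
    x 5 * y 0 - x 0 * y 5 + (x 4 * y 1 - x 1 * y 4) + w * (x 2 * y 1 - x 1 * y 2),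
    x 6 * y 0 - x 0 * y 6 + (x 5 * y 1 - x 1 * y 5) + w * (x 3 * y 1 - x 1 * y 3)
      + k * (x 2 * y 1 - x 1 * y 2) + l * (x 4 * y 1 - x 1 * y 4)
      - l * (x 3 * y 2 - x 2 * y 3)]

section
variable (x y : Cover w k l)
@[simp] lemma lie0 : ⁅x, y⁆ 0 = 0 := rfl
@[simp] lemma lie1 : ⁅x, y⁆ 1 = 0 := rfl
@[simp] lemma lie2 : ⁅x, y⁆ 2 = x 1 * y 0 - x 0 * y 1 := rfl
@[simp] lemma lie3 : ⁅x, y⁆ 3 = x 2 * y 0 - x 0 * y 2 := rfl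
@[simp] lemma lie4 : ⁅x, y⁆ 4 = x 3 * y 0 - x 0 * y 3 + (x 2 * y 1 - x 1 * y 2) := rfl
@[simp] lemma lie5 : ⁅x, y⁆ 5 = x 4 * y 0 - x 0 * y 4 + (x 3 * y 1 - x 1 * y 3) := rfl
@[simp] lemma lie6 : ⁅x, y⁆ 6 = x 5 * y 0 - x 0 * y 5 + (x 4 * y 1 - x 1 * y 4)
    + w * (x 2 * y 1 - x 1 * y 2) := rfl
@[simp] lemma lie7 : ⁅x, y⁆ 7 = x 6 * y 0 - x 0 * y 6 + (x 5 * y 1 - x 1 * y 5)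
    + w * (x 3 * y 1 - x 1 * y 3) + k * (x 2 * y 1 - x 1 * y 2) + l * (x 4 * y 1 - x 1 * y 4)
    - l * (x 3 * y 2 - x 2 * y 3) := rfl
end

instance : LieRing (Cover w k l) where
  add_lie x y z := by apply ext8 <;> simp <;> ring
  lie_add x y z := by apply ext8 <;> simp <;> ring
  lie_self x := by apply ext8 <;> simp <;> ring
  leibniz_lie x y z := by apply ext8 <;> simp <;> ring

/-- The elements whose coordinates of index at most `j` vanish. -/
def fil (w k l : ℤ) (j : ℕ) : LieIdeal ℤ (Cover w k l) where
  carrier := {x | ∀ i : Fin 8, i.val ≤ j → x i = 0}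
  add_mem' hx hy i hi := by simp [hx i hi, hy i hi]
  zero_mem' i _ := rfl
  smul_mem' c x hx i hi := by simp [hx i hi]
  lie_mem {x y} hy i hi := by
    fin_cases i
    · simp
    · simp
    · simp [hy 0 (by simp), hy 1 (by simp at hi ⊢; omega)]
    · simp [hy 0 (by simp), hy 2 (by simp at hi ⊢; omega)]
    · simp [hy 0 (by simp), hy 1 (by simp at hi ⊢; omega), hy 2 (by simp at hi ⊢; omega),
        hy 3 (by simp at hi ⊢; omega)]
    · simp [hy 0 (by simp), hy 1 (by simp at hi ⊢; omega), hy 3 (by simp at hi ⊢; omega),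
        hy 4 (by simp at hi ⊢; omega)]
    · simp [hy 0 (by simp), hy 1 (by simp at hi ⊢; omega), hy 2 (by simp at hi ⊢; omega),
        hy 4 (by simp at hi ⊢; omega), hy 5 (by simp at hi ⊢; omega)]
    · simp [hy 0 (by simp), hy 1 (by simp at hi ⊢; omega), hy 2 (by simp at hi ⊢; omega),
        hy 3 (by simp at hi ⊢; omega), hy 4 (by simp at hi ⊢; omega),
        hy 5 (by simp at hi ⊢; omega), hy 6 (by simp at hi ⊢; omega)]

lemma mem_fil {j : ℕ} {x : Cover w k l} :
    x ∈ fil w k l j ↔ ∀ i : Fin 8, i.val ≤ j → x i = 0 := Iff.rfl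

lemma lowerCentralSeries_le_fil (j : ℕ) :
    LieModule.lowerCentralSeries ℤ (Cover w k l) (Cover w k l) (j + 1) ≤ fil w k l (j + 1) := by
  induction j with
  | zero =>
    rw [LieModule.lowerCentralSeries_succ, LieSubmodule.lie_le_iff]
    intro x _ y _ i hi
    obtain rfl | rfl : i = 0 ∨ i = 1 := by omega
    · simp
    · simp
  | succ j ih =>
    rw [LieModule.lowerCentralSeries_succ, LieSubmodule.lie_le_iff]
    intro x _ y hy i hi
    replace hy := mem_fil.1 (ih hy)
    have h0 := hy 0 (by simp)
    have h1 := hy 1 (by simp)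
    fin_cases i
    · simp
    · simp
    · simp [h0, h1]
    · simp [h0, hy 2 (by simp at hi ⊢; omega)]
    · simp [h0, h1, hy 2 (by simp at hi ⊢; omega), hy 3 (by simp at hi ⊢; omega)]
    · simp [h0, h1, hy 3 (by simp at hi ⊢; omega), hy 4 (by simp at hi ⊢; omega)]
    · simp [h0, h1, hy 2 (by simp at hi ⊢; omega), hy 4 (by simp at hi ⊢; omega),
        hy 5 (by simp at hi ⊢; omega)]
    · simp [h0, h1, hy 2 (by simp at hi ⊢; omega), hy 3 (by simp at hi ⊢; omega),
        hy 4 (by simp at hi ⊢; omega), hy 5 (by simp at hi ⊢; omega),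
        hy 6 (by simp at hi ⊢; omega)]

/-- The ideal generated by `p cᵢ`, `p a - m c₇` and `p b - n c₇`. -/
def relIdeal (w k l : ℤ) (p : ℕ) (m n : ℤ) : LieIdeal ℤ (Cover w k l) where
  carrier := {x | (∃ i j : ℤ, x 0 = p * i ∧ x 1 = p * j ∧ (p : ℤ) ∣ x 7 + i * m + j * n) ∧
    (p : ℤ) ∣ x 2 ∧ (p : ℤ) ∣ x 3 ∧ (p : ℤ) ∣ x 4 ∧ (p : ℤ) ∣ x 5 ∧ (p : ℤ) ∣ x 6}
  add_mem' := by
    rintro x y ⟨⟨i, j, h0, h1, h7⟩, h2, h3, h4, h5, h6⟩ ⟨⟨i', j', g0, g1, g7⟩, g2, g3, g4, g5, g6⟩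
    refine ⟨⟨i + i', j + j', by simp [h0, g0]; ring, by simp [h1, g1]; ring, ?_⟩,
      h2.add g2, h3.add g3, h4.add g4, h5.add g5, h6.add g6⟩
    obtain ⟨d, hd⟩ := h7
    obtain ⟨e, he⟩ := g7
    refine ⟨d + e, ?_⟩
    change x 7 + y 7 + (i + i') * m + (j + j') * n = p * (d + e)
    linear_combination hd + he
  zero_mem' := ⟨⟨0, 0, by simp⟩, by simp⟩
  smul_mem' := by
    rintro c x ⟨⟨i, j, h0, h1, h7⟩, h2, h3, h4, h5, h6⟩
    refine ⟨⟨c * i, c * j, by simp [h0]; ring, by simp [h1]; ring, ?_⟩,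
      h2.mul_left c, h3.mul_left c, h4.mul_left c, h5.mul_left c, h6.mul_left c⟩
    obtain ⟨d, hd⟩ := h7
    refine ⟨c * d, ?_⟩
    change c * x 7 + c * i * m + c * j * n = p * (c * d)
    linear_combination c * hd
  lie_mem := by
    rintro x y ⟨⟨i, j, h0, h1, h7⟩, ⟨a2, h2⟩, ⟨a3, h3⟩, ⟨a4, h4⟩, ⟨a5, h5⟩, ⟨a6, h6⟩⟩
    refine ⟨⟨0, 0, by simp, by simp, ?_⟩, ?_, ?_, ?_, ?_, ?_⟩
    · refine ⟨x 6 * i - x 0 * a6 + (x 5 * j - x 1 * a5) + w * (x 3 * j - x 1 * a3)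
        + k * (x 2 * j - x 1 * a2) + l * (x 4 * j - x 1 * a4) - l * (x 3 * a2 - x 2 * a3), ?_⟩
      simp [h0, h1, h2, h3, h4, h5, h6]; ring
    · exact ⟨x 1 * i - x 0 * j, by simp [h0, h1]; ring⟩
    · exact ⟨x 2 * i - x 0 * a2, by simp [h0, h2]; ring⟩
    · exact ⟨x 3 * i - x 0 * a3 + (x 2 * j - x 1 * a2), by simp [h0, h1, h2, h3]; ring⟩
    · exact ⟨x 4 * i - x 0 * a4 + (x 3 * j - x 1 * a3), by simp [h0, h1, h3, h4]; ring⟩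
    · exact ⟨x 5 * i - x 0 * a5 + (x 4 * j - x 1 * a4) + w * (x 2 * j - x 1 * a2),
        by simp [h0, h1, h2, h4, h5]; ring⟩

lemma mem_relIdeal {p : ℕ} {m n : ℤ} {x : Cover w k l} : x ∈ relIdeal w k l p m n ↔
    (∃ i j : ℤ, x 0 = p * i ∧ x 1 = p * j ∧ (p : ℤ) ∣ x 7 + i * m + j * n) ∧
    (p : ℤ) ∣ x 2 ∧ (p : ℤ) ∣ x 3 ∧ (p : ℤ) ∣ x 4 ∧ (p : ℤ) ∣ x 5 ∧ (p : ℤ) ∣ x 6 := Iff.rfl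

/-- The ideal generated by `c₇` and `p` times everything. -/
def topIdeal (w k l : ℤ) (p : ℕ) : LieIdeal ℤ (Cover w k l) where
  carrier := {x | ∀ i : Fin 8, i.val ≤ 6 → (p : ℤ) ∣ x i}
  add_mem' hx hy i hi := (hx i hi).add (hy i hi)
  zero_mem' i _ := by simp
  smul_mem' c x hx i hi := (hx i hi).mul_left c
  lie_mem {x y} hy i hi := by
    obtain ⟨a0, h0⟩ := hy 0 (by simp)
    obtain ⟨a1, h1⟩ := hy 1 (by simp)
    obtain ⟨a2, h2⟩ := hy 2 (by simp)
    obtain ⟨a3, h3⟩ := hy 3 (by simp)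
    obtain ⟨a4, h4⟩ := hy 4 (by simp)
    obtain ⟨a5, h5⟩ := hy 5 (by simp)
    fin_cases i
    · simp
    · simp
    · exact ⟨x 1 * a0 - x 0 * a1, by simp [h0, h1]; ring⟩
    · exact ⟨x 2 * a0 - x 0 * a2, by simp [h0, h2]; ring⟩
    · exact ⟨x 3 * a0 - x 0 * a3 + (x 2 * a1 - x 1 * a2), by simp [h0, h1, h2, h3]; ring⟩
    · exact ⟨x 4 * a0 - x 0 * a4 + (x 3 * a1 - x 1 * a3), by simp [h0, h1, h3, h4]; ring⟩
    · exact ⟨x 5 * a0 - x 0 * a5 + (x 4 * a1 - x 1 * a4) + w * (x 2 * a1 - x 1 * a2),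
        by simp [h0, h1, h2, h4, h5]; ring⟩
    · simp at hi

end Cover

/-- `v = (a, b, c₂, …, c₇)` satisfies the defining relations of `Cover` up to central
correction terms `X` and `Y`. -/
structure CoverRel {L : Type*} [LieRing L] (p : ℕ) (w : ℤ) (v : Fin 8 → L) (X Y : L) : Prop where
  e2 : ⁅v 1, v 0⁆ = v 2
  e3 : ⁅v 2, v 0⁆ = v 3
  e4 : ⁅v 3, v 0⁆ = v 4
  e5 : ⁅v 4, v 0⁆ = v 5
  e6 : ⁅v 5, v 0⁆ = v 6
  e7 : ⁅v 6, v 0⁆ = v 7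
  rel : ⁅v 2, v 1⁆ = v 4 + w • v 6 + X
  rel' : ⁅v 4, v 1⁆ = v 6 + Y
  hX : ∀ x : L, ⁅X, x⁆ = 0
  hY : ∀ x : L, ⁅Y, x⁆ = 0
  h7 : ∀ x : L, ⁅v 7, x⁆ = 0
  h8 : ∀ x : L, ⁅⁅v 6, v 1⁆, x⁆ = 0
  tors : (p : ℤ) • v 2 = 0

lemma lie_lie_right {L : Type*} [LieRing L] (x y z : L) :
    ⁅⁅x, y⁆, z⁆ = ⁅⁅x, z⁆, y⁆ + ⁅x, ⁅y, z⁆⁆ := by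
  rw [lie_lie x y z, ← lie_skew y ⁅x, z⁆, sub_neg_eq_add, add_comm]

namespace CoverRel

variable {L : Type*} [LieRing L] {p : ℕ} {w : ℤ} {v : Fin 8 → L} {X Y : L}

lemma tors3 (h : CoverRel p w v X Y) : (p : ℤ) • v 3 = 0 := by
  rw [← h.e3, ← zsmul_lie, h.tors, zero_lie]
lemma tors4 (h : CoverRel p w v X Y) : (p : ℤ) • v 4 = 0 := by
  rw [← h.e4, ← zsmul_lie, h.tors3, zero_lie]
lemma tors5 (h : CoverRel p w v X Y) : (p : ℤ) • v 5 = 0 := by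
  rw [← h.e5, ← zsmul_lie, h.tors4, zero_lie]
lemma tors6 (h : CoverRel p w v X Y) : (p : ℤ) • v 6 = 0 := by
  rw [← h.e6, ← zsmul_lie, h.tors5, zero_lie]
lemma tors7 (h : CoverRel p w v X Y) : (p : ℤ) • v 7 = 0 := by
  rw [← h.e7, ← zsmul_lie, h.tors6, zero_lie]

lemma b01 (h : CoverRel p w v X Y) : ⁅v 0, v 1⁆ = -v 2 := by rw [← h.e2, lie_skew]
lemma b02 (h : CoverRel p w v X Y) : ⁅v 0, v 2⁆ = -v 3 := by rw [← h.e3, lie_skew]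
lemma b03 (h : CoverRel p w v X Y) : ⁅v 0, v 3⁆ = -v 4 := by rw [← h.e4, lie_skew]

lemma b31 (h : CoverRel p w v X Y) : ⁅v 3, v 1⁆ = v 5 + w • v 7 := by
  rw [← h.e3, lie_lie_right, h.rel, h.b01, lie_neg, lie_self, add_lie, add_lie, zsmul_lie, h.e5,
    h.e7, h.hX]
  simp

lemma b32 (h : CoverRel p w v X Y) : ⁅v 3, v 2⁆ = -Y := by
  have := lie_lie_right (v 3) (v 1) (v 0)
  rw [h.b31, h.e4, h.rel', h.e2, add_lie, zsmul_lie, h.h7, h.e6] at this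
  rw [smul_zero, add_zero, add_assoc, left_eq_add] at this
  exact eq_neg_of_add_eq_zero_right this

lemma b42 (h : CoverRel p w v X Y) : ⁅v 4, v 2⁆ = 0 := by
  rw [← h.e4, lie_lie_right, h.b32, h.b02, neg_lie, h.hY, lie_neg, lie_self]
  simp

lemma b51 (h : CoverRel p w v X Y) : ⁅v 5, v 1⁆ = v 7 := by
  rw [← h.e5, lie_lie_right, h.rel', h.b01, lie_neg, h.b42, add_lie, h.hY, h.e7]
  simp

lemma b52 (h : CoverRel p w v X Y) : ⁅v 5, v 2⁆ = -⁅v 4, v 3⁆ := by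
  rw [← h.e5, lie_lie_right, h.b42, h.b02, lie_neg]
  simp

lemma b61' (h : CoverRel p w v X Y) : ⁅v 6, v 1⁆ = ⁅v 4, v 3⁆ := by
  rw [← h.e6, lie_lie_right, h.b51, h.b01, lie_neg, h.b52, h.h7]
  simp

lemma b62 (h : CoverRel p w v X Y) : ⁅v 6, v 2⁆ = 0 := by
  have := lie_lie_right (v 6) (v 1) (v 0)
  rw [h.h8, h.e7, h.h7, h.e2, zero_add] at this
  exact this.symm

lemma b6_lie (h : CoverRel p w v X Y) (x : L) (hx : ⁅v 6, x⁆ = 0) : ⁅v 6, ⁅x, v 0⁆⁆ = 0 := by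
  have := lie_lie_right (v 6) x (v 0)
  rw [hx, h.e7, h.h7, zero_lie, zero_add] at this
  exact this.symm

lemma b63 (h : CoverRel p w v X Y) : ⁅v 6, v 3⁆ = 0 := by rw [← h.e3]; exact h.b6_lie _ h.b62
lemma b64 (h : CoverRel p w v X Y) : ⁅v 6, v 4⁆ = 0 := by rw [← h.e4]; exact h.b6_lie _ h.b63
lemma b65 (h : CoverRel p w v X Y) : ⁅v 6, v 5⁆ = 0 := by rw [← h.e5]; exact h.b6_lie _ h.b64

lemma b61 (h : CoverRel p w v X Y) (hp : Odd p) : ⁅v 6, v 1⁆ = 0 := by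
  have h2 : (2 : ℤ) • ⁅v 4, v 3⁆ = 0 := by
    have := lie_lie_right (v 3) (v 2) (v 1)
    rw [h.b32, neg_lie, h.hY, neg_zero, h.b31, h.rel, add_lie, h.b52, zsmul_lie, h.h7, lie_add,
      lie_add, lie_zsmul, ← lie_skew (v 3) (v 6), h.b63, ← lie_skew (v 3) X, h.hX,
      ← lie_skew (v 3) (v 4)] at this
    rw [two_smul, ← neg_eq_zero, neg_add, eq_comm]
    simpa only [neg_zero, smul_zero, add_zero] using this
  have hp' : (p : ℤ) • ⁅v 4, v 3⁆ = 0 := by rw [← zsmul_lie, h.tors4, zero_lie]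
  rw [h.b61']
  obtain ⟨q, rfl⟩ := hp
  push_cast at hp'
  rwa [add_smul, mul_comm, mul_smul, h2, smul_zero, zero_add, one_smul] at hp'

lemma b43 (h : CoverRel p w v X Y) (hp : Odd p) : ⁅v 4, v 3⁆ = 0 := by rw [← h.b61', h.b61 hp]
lemma b52' (h : CoverRel p w v X Y) (hp : Odd p) : ⁅v 5, v 2⁆ = 0 := by
  rw [h.b52, h.b43 hp, neg_zero]

lemma b53 (h : CoverRel p w v X Y) (hp : Odd p) : ⁅v 5, v 3⁆ = 0 := by
  rw [← h.e5, lie_lie_right, h.b43 hp, h.b03, lie_neg, lie_self]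
  simp

lemma b54 (h : CoverRel p w v X Y) (hp : Odd p) : ⁅v 5, v 4⁆ = 0 := by
  have := lie_lie_right (v 5) (v 3) (v 0)
  rw [h.b53 hp, h.e6, h.b63, h.e4, zero_lie, zero_add] at this
  exact this.symm

/-- The homomorphism from `Cover` determined by elements satisfying its relations. -/
def toHom {k l : ℤ} (h : CoverRel p w v (k • v 7) (l • v 7)) (hp : Odd p) :
    Cover w k l →ₗ⁅ℤ⁆ L where
  toFun x := ∑ i, x i • v i
  map_add' x y := by simp [add_smul, Finset.sum_add_distrib]
  map_smul' c x := by simp [mul_smul, Finset.smul_sum]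
  map_lie' {x y} := by
    have e7 (u : L) : ⁅u, v 7⁆ = 0 := by rw [← lie_skew, h.h7, neg_zero]
    have s (i j : Fin 8) (u : L) (hu : ⁅v i, v j⁆ = u) : ⁅v j, v i⁆ = -u := by rw [← hu, lie_skew]
    simp only [Fin.sum_univ_eight, Cover.lie0, Cover.lie1, Cover.lie2, Cover.lie3, Cover.lie4,
      Cover.lie5, Cover.lie6, Cover.lie7, add_lie, lie_add, zsmul_lie, lie_zsmul, lie_self, e7,
      h.h7, h.e2, h.e3, h.e4, h.e5, h.e6, h.e7, h.rel, h.rel', h.b31, h.b32, h.b42, h.b51,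
      h.b52' hp, h.b61 hp, h.b62, h.b63, h.b64, h.b65, h.b43 hp, h.b53 hp, h.b54 hp,
      s _ _ _ h.e2, s _ _ _ h.e3, s _ _ _ h.e4, s _ _ _ h.e5, s _ _ _ h.e6, s _ _ _ h.e7,
      s _ _ _ h.rel, s _ _ _ h.rel', s _ _ _ h.b31, s _ _ _ h.b32, s _ _ _ h.b42, s _ _ _ h.b51,
      s _ _ _ (h.b52' hp), s _ _ _ (h.b61 hp), s _ _ _ h.b62, s _ _ _ h.b63, s _ _ _ h.b64,
      s _ _ _ h.b65, s _ _ _ (h.b43 hp), s _ _ _ (h.b53 hp), s _ _ _ (h.b54 hp)]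
    module

lemma toHom_apply {k l : ℤ} (h : CoverRel p w v (k • v 7) (l • v 7)) (hp : Odd p)
    (x : Cover w k l) : h.toHom hp x = ∑ i, x i • v i := rfl

end CoverRel

/-- An additive map of Lie rings preserving brackets. -/
def IsLieHom {A B : Type*} [LieRing A] [LieRing B] (f : A →+ B) : Prop :=
  ∀ x y, f ⁅x, y⁆ = ⁅f x, f y⁆

section LieHom

variable {A B C : Type*} [LieRing A] [LieRing B] [LieRing C]

/-- The morphism of Lie algebras over `ℤ` given by an additive map preserving brackets. -/
def IsLieHom.toLieHom {f : A →+ B} (hf : IsLieHom f) : A →ₗ⁅ℤ⁆ B :=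
  { f.toIntLinearMap with map_lie' := hf _ _ }

lemma IsLieHom.exists_mem_lowerCentralSeries {f : A →+ B} (hf : IsLieHom f)
    (hs : Function.Surjective f) {j : ℕ} {y : B} (hy : y ∈ LieModule.lowerCentralSeries ℤ B B j) :
    ∃ x ∈ LieModule.lowerCentralSeries ℤ A A j, f x = y := by
  rw [← LieIdeal.lowerCentralSeries_map_eq (f := hf.toLieHom) j hs] at hy
  obtain ⟨x, hx⟩ := LieIdeal.mem_map_of_surjective hs hy
  exact ⟨x, x.2, hx⟩

lemma IsLieHom.map_mem_lowerCentralSeries {f : A →+ B} (hf : IsLieHom f) {j : ℕ} {x : A}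
    (hx : x ∈ LieModule.lowerCentralSeries ℤ A A j) :
    f x ∈ LieModule.lowerCentralSeries ℤ B B j :=
  LieIdeal.map_lowerCentralSeries_le (f := hf.toLieHom) j (LieIdeal.mem_map hx)

lemma IsLieHom.comp {g : B →+ C} {f : A →+ B} (hg : IsLieHom g) (hf : IsLieHom f) :
    IsLieHom (g.comp f) := fun x y ↦ by simp [hf x y, hg _ _]

lemma lie_mem_lowerCentralSeries_succ {j : ℕ} {x : A}
    (hx : x ∈ LieModule.lowerCentralSeries ℤ A A j) (y : A) :
    ⁅x, y⁆ ∈ LieModule.lowerCentralSeries ℤ A A (j + 1) := by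
  rw [← lie_skew, neg_mem_iff, LieModule.lowerCentralSeries_succ]
  exact LieSubmodule.lie_mem_lie (LieSubmodule.mem_top y) hx

lemma isLieIso_of_ker_eq {f : A →+ B} {g : A →+ C} (hf : IsLieHom f) (hg : IsLieHom g)
    (hfs : Function.Surjective f) (hgs : Function.Surjective g)
    (h : ∀ x, f x = 0 ↔ g x = 0) : IsLieIso B C := by
  have key : ∀ x y, f x = f y ↔ g x = g y := fun x y ↦ by
    rw [← sub_eq_zero, ← map_sub, h, map_sub, sub_eq_zero]
  let s := Function.surjInv hfs
  have hs : ∀ b, f (s b) = b := Function.surjInv_eq hfs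
  refine ⟨Equiv.ofBijective (fun b ↦ g (s b)) ⟨fun b b' hb ↦ ?_, fun c ↦ ?_⟩, fun b b' ↦ ?_,
    fun b b' ↦ ?_⟩
  · rw [← hs b, ← hs b']
    exact (key _ _).2 hb
  · obtain ⟨x, rfl⟩ := hgs c
    exact ⟨f x, (key _ _).1 (hs _)⟩
  · change g _ = g _ + g _
    rw [← map_add]
    exact (key _ _).1 (by rw [map_add, hs, hs, hs])
  · change g _ = ⁅g _, g _⁆
    rw [← hg]
    exact (key _ _).1 (by rw [hf, hs, hs, hs])

lemma IsLieIso.exists_hom (h : IsLieIso A B) :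
    ∃ f : A →+ B, IsLieHom f ∧ Function.Bijective f := by
  obtain ⟨e, h1, h2⟩ := h
  exact ⟨AddMonoidHom.mk' e h1, h2, e.bijective⟩

/-- The quotient map by a Lie ideal. -/
def idealMk (I : LieIdeal ℤ A) : A →+ A ⧸ I where
  toFun := LieSubmodule.Quotient.mk
  map_zero' := rfl
  map_add' _ _ := rfl

lemma isLieHom_idealMk (I : LieIdeal ℤ A) : IsLieHom (idealMk I) := fun _ _ ↦ rfl

lemma idealMk_surjective (I : LieIdeal ℤ A) : Function.Surjective (idealMk I) :=
  LieSubmodule.Quotient.surjective_mk' I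

lemma idealMk_eq_zero {I : LieIdeal ℤ A} {x : A} : idealMk I x = 0 ↔ x ∈ I :=
  LieSubmodule.Quotient.mk_eq_zero'

end LieHom

lemma exists_free_hom {A : Type*} [LieRing A] (x y : A) :
    ∃ f : FL →+ A, IsLieHom f ∧ f ga = x ∧ f gb = y := by
  let F := FreeLieAlgebra.lift ℤ ![x, y]
  refine ⟨AddMonoidHom.mk' F (map_add F), fun u v ↦ LieHom.map_lie F u v, ?_, ?_⟩
  · exact FreeLieAlgebra.lift_of_apply ![x, y] 0
  · exact FreeLieAlgebra.lift_of_apply ![x, y] 1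

lemma mem_of_forall_of_mem {R X : Type*} [CommRing R] (N : LieSubalgebra R (FreeLieAlgebra R X))
    (h : ∀ i, FreeLieAlgebra.of R i ∈ N) (x : FreeLieAlgebra R X) : x ∈ N := by
  let F : FreeLieAlgebra R X →ₗ⁅R⁆ N := FreeLieAlgebra.lift R fun i ↦ ⟨_, h i⟩
  have hF : N.incl.comp F = LieHom.id := by
    apply FreeLieAlgebra.hom_ext
    intro i
    rw [LieHom.comp_apply, FreeLieAlgebra.lift_of_apply]
    rfl
  have : ((F x : N) : FreeLieAlgebra R X) = x := LieHom.congr_fun hF x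
  rw [← this]
  exact (F x).2

lemma free_induction (S : AddSubgroup FL) (hS : ∀ x ∈ S, ∀ y ∈ S, ⁅x, y⁆ ∈ S) (ha : ga ∈ S)
    (hb : gb ∈ S) (x : FL) : x ∈ S := by
  refine mem_of_forall_of_mem (R := ℤ) (X := Fin 2)
    { S with
      smul_mem' := fun c x hx ↦ S.zsmul_mem hx c
      lie_mem' := fun hx hy ↦ hS _ hx _ hy } (fun i ↦ ?_) x
  fin_cases i
  · exact ha
  · exact hb

section Word

variable {A B : Type*} [LieRing A] [LieRing B]

/-- The elements `a, b, c₂ = [b,a], …, c₇ = [b,a,a,a,a,a,a]`. -/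
def word (a b : A) : Fin 8 → A :=
  ![a, b, ⁅b, a⁆, ⁅⁅b, a⁆, a⁆, ⁅⁅⁅b, a⁆, a⁆, a⁆, ⁅⁅⁅⁅b, a⁆, a⁆, a⁆, a⁆, ⁅⁅⁅⁅⁅b, a⁆, a⁆, a⁆, a⁆, a⁆,
    ⁅⁅⁅⁅⁅⁅b, a⁆, a⁆, a⁆, a⁆, a⁆, a⁆]

lemma IsLieHom.map_word {f : A →+ B} (hf : IsLieHom f) (a b : A) (i : Fin 8) :
    f (word a b i) = word (f a) (f b) i := by
  fin_cases i
  · rfl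
  · rfl
  · exact hf _ _
  · change f _ = ⁅⁅f b, f a⁆, f a⁆
    rw [← hf, ← hf]
    rfl
  · change f _ = ⁅⁅⁅f b, f a⁆, f a⁆, f a⁆
    rw [← hf, ← hf, ← hf]
    rfl
  · change f _ = ⁅⁅⁅⁅f b, f a⁆, f a⁆, f a⁆, f a⁆
    rw [← hf, ← hf, ← hf, ← hf]
    rfl
  · change f _ = ⁅⁅⁅⁅⁅f b, f a⁆, f a⁆, f a⁆, f a⁆, f a⁆
    rw [← hf, ← hf, ← hf, ← hf, ← hf]
    rfl
  · change f _ = ⁅⁅⁅⁅⁅⁅f b, f a⁆, f a⁆, f a⁆, f a⁆, f a⁆, f a⁆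
    rw [← hf, ← hf, ← hf, ← hf, ← hf, ← hf]
    rfl

lemma word_mem_lowerCentralSeries (a b : A) (j : ℕ) (hj : j + 1 < 8) :
    word a b ⟨j + 1, hj⟩ ∈ LieModule.lowerCentralSeries ℤ A A j := by
  have h1 : ⁅b, a⁆ ∈ LieModule.lowerCentralSeries ℤ A A 1 :=
    lie_mem_lowerCentralSeries_succ (j := 0) (by simp) a
  have h2 := lie_mem_lowerCentralSeries_succ h1 a
  have h3 := lie_mem_lowerCentralSeries_succ h2 a
  have h4 := lie_mem_lowerCentralSeries_succ h3 a
  have h5 := lie_mem_lowerCentralSeries_succ h4 a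
  have h6 := lie_mem_lowerCentralSeries_succ h5 a
  obtain rfl | rfl | rfl | rfl | rfl | rfl | rfl : j = 0 ∨ j = 1 ∨ j = 2 ∨ j = 3 ∨ j = 4 ∨ j = 5 ∨
    j = 6 := by omega
  exacts [by simp, h1, h2, h3, h4, h5, h6]

lemma lie_eq_zero_of_mem {j : ℕ} (h : LieModule.lowerCentralSeries ℤ A A (j + 1) = ⊥) {x : A}
    (hx : x ∈ LieModule.lowerCentralSeries ℤ A A j) (y : A) : ⁅x, y⁆ = 0 := by
  have := lie_mem_lowerCentralSeries_succ hx y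
  rwa [h] at this

lemma CoverRel.of_word {p : ℕ} {w : ℤ} {a b X Y : A}
    (rel : ⁅word a b 2, b⁆ = word a b 4 + w • word a b 6 + X)
    (rel' : ⁅word a b 4, b⁆ = word a b 6 + Y)
    (hX : ∀ x : A, ⁅X, x⁆ = 0) (hY : ∀ x : A, ⁅Y, x⁆ = 0)
    (h : LieModule.lowerCentralSeries ℤ A A 7 = ⊥) (tors : ∀ x : A, ⁅(p : ℤ) • b, x⁆ = 0) :
    CoverRel p w (word a b) X Y where
  e2 := rfl
  e3 := rfl
  e4 := rfl
  e5 := rfl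
  e6 := rfl
  e7 := rfl
  rel := rel
  rel' := rel'
  hX := hX
  hY := hY
  h7 := lie_eq_zero_of_mem (j := 6 + 0) h (word_mem_lowerCentralSeries a b 6 _)
  h8 := lie_eq_zero_of_mem (j := 6 + 0) h
    (lie_mem_lowerCentralSeries_succ (word_mem_lowerCentralSeries a b 5 (by simp)) _)
  tors := (zsmul_lie b a p).symm.trans (tors a)

lemma IsLieHom.surjective_of_mem_range {f : A →+ B} (hf : IsLieHom f) {g : FL →+ B}
    (hg : IsLieHom g) (hgs : Function.Surjective g) (ha : g ga ∈ f.range) (hb : g gb ∈ f.range) :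
    Function.Surjective f := by
  intro y
  obtain ⟨x, rfl⟩ := hgs y
  refine free_induction (f.range.comap g) ?_ ha hb x
  rintro x ⟨x', hx⟩ y ⟨y', hy⟩
  exact ⟨⁅x', y'⁆, by rw [hf, hg, hx, hy]⟩

end Word

namespace Cover

variable {w k l : ℤ}

/-- The standard basis. -/
def e (i : Fin 8) : Cover w k l := of (Pi.single i 1)

@[simp] lemma e_apply (i j : Fin 8) : (e i : Cover w k l) j = if j = i then 1 else 0 := by
  simp [e, Pi.single_apply]

lemma word_e (i : Fin 8) : word (e 0 : Cover w k l) (e 1) i = e i := by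
  have h2 : ⁅(e 1 : Cover w k l), (e 0 : Cover w k l)⁆ = e 2 := by apply ext8 <;> simp
  have h3 : ⁅(e 2 : Cover w k l), (e 0 : Cover w k l)⁆ = e 3 := by apply ext8 <;> simp
  have h4 : ⁅(e 3 : Cover w k l), (e 0 : Cover w k l)⁆ = e 4 := by apply ext8 <;> simp
  have h5 : ⁅(e 4 : Cover w k l), (e 0 : Cover w k l)⁆ = e 5 := by apply ext8 <;> simp
  have h6 : ⁅(e 5 : Cover w k l), (e 0 : Cover w k l)⁆ = e 6 := by apply ext8 <;> simp
  have h7 : ⁅(e 6 : Cover w k l), (e 0 : Cover w k l)⁆ = e 7 := by apply ext8 <;> simp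
  change ![_, _, _, _, _, _, _, _] i = _
  rw [h2, h3, h4, h5, h6, h7]
  fin_cases i <;> rfl

lemma sum_smul_e (x : Cover w k l) : ∑ i, x i • (e i : Cover w k l) = x := by
  rw [Fin.sum_univ_eight]
  apply ext8 <;> simp

lemma map_eq_sum {A : Type*} [LieRing A] {f : Cover w k l →+ A} (hf : IsLieHom f)
    (x : Cover w k l) : f x = ∑ i, x i • word (f (e 0)) (f (e 1)) i := by
  conv_lhs => rw [← sum_smul_e x]
  rw [map_sum]
  refine Finset.sum_congr rfl fun i _ ↦ ?_
  rw [map_zsmul, ← hf.map_word, word_e]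

end Cover

/-- The relators of `M`, in the free Lie ring on two generators. -/
abbrev relators (w : ℤ) : Set FL := {bab - ba3 - w • ba5, ba3b - ba5}

lemma lowerCentralSeries_presLie (p : ℕ) (R : Set FL) :
    LieModule.lowerCentralSeries ℤ (presLie p R) (presLie p R) 6 = ⊥ := by
  rw [eq_bot_iff]
  intro y hy
  obtain ⟨x, hx, rfl⟩ := (isLieHom_idealMk _).exists_mem_lowerCentralSeries
    (idealMk_surjective _) hy
  rw [LieSubmodule.mem_bot, idealMk_eq_zero]
  exact LieSubmodule.mem_sup_right hx

lemma exists_hom_presLie (p : ℕ) (hp : Odd p) (w k l : ℤ) :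
    ∃ θ : Cover w k l →+ presLie p (relators w), IsLieHom θ ∧ Function.Surjective θ ∧
      ∀ x, θ x = 0 ↔ x ∈ Cover.topIdeal w k l p := by
  let T : LieIdeal ℤ FL := LieSubmodule.lieSpan ℤ FL (relators w ∪ {p • ga, p • gb}) ⊔
    LieModule.lowerCentralSeries ℤ FL FL 6
  let q : FL →+ presLie p (relators w) := idealMk T
  have hq : IsLieHom q := isLieHom_idealMk T
  have hrel {x : FL} (hx : x ∈ relators w ∪ {p • ga, p • gb}) : q x = 0 :=
    idealMk_eq_zero.2 (LieSubmodule.mem_sup_left (LieSubmodule.subset_lieSpan hx))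
  have h6 := lowerCentralSeries_presLie p (relators w)
  have h7 : LieModule.lowerCentralSeries ℤ (presLie p (relators w))
      (presLie p (relators w)) 7 = ⊥ :=
    eq_bot_iff.2 (h6 ▸ LieModule.antitone_lowerCentralSeries _ _ _ (by simp))
  have hw7 : word (q ga) (q gb) 7 = 0 := by
    have := word_mem_lowerCentralSeries (q ga) (q gb) 6 (by simp)
    rwa [h6] at this
  have hr1 := hrel (x := bab - ba3 - w • ba5) (by simp)
  have hr2 := hrel (x := ba3b - ba5) (by simp)
  have hr3 := hrel (x := p • ga) (by simp)
  have hr4 := hrel (x := p • gb) (by simp)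
  rw [map_sub, map_sub, map_zsmul, sub_eq_zero, sub_eq_iff_eq_add] at hr1
  rw [map_sub, sub_eq_zero] at hr2
  rw [map_nsmul] at hr3 hr4
  have hC : CoverRel p w (word (q ga) (q gb)) (k • word (q ga) (q gb) 7)
      (l • word (q ga) (q gb) 7) := by
    refine CoverRel.of_word ?_ ?_ ?_ ?_ h7 ?_
    · rw [hw7, smul_zero, add_zero, add_comm, ← hq.map_word, ← hq.map_word, ← hq.map_word, ← hq]
      exact hr1
    · rw [hw7, smul_zero, add_zero, ← hq.map_word, ← hq.map_word, ← hq]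
      exact hr2
    · simp [hw7]
    · simp [hw7]
    · intro x
      rw [(natCast_zsmul _ _).trans hr4, zero_lie]
  let F := hC.toHom hp
  let θ : Cover w k l →+ presLie p (relators w) := AddMonoidHom.mk' F (map_add F)
  have hθ : IsLieHom θ := fun x y ↦ LieHom.map_lie F x y
  have hθs (x) : θ x = ∑ i, x i • word (q ga) (q gb) i := hC.toHom_apply hp x
  refine ⟨θ, hθ, ?_, fun x ↦ ⟨fun hx ↦ ?_, fun hx ↦ ?_⟩⟩
  · refine hθ.surjective_of_mem_range hq (idealMk_surjective T) ⟨Cover.e 0, ?_⟩ ⟨Cover.e 1, ?_⟩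
    · rw [hθs, Fin.sum_univ_eight]
      simp
      rfl
    · rw [hθs, Fin.sum_univ_eight]
      simp
      rfl
  · obtain ⟨g, hg, hga, hgb⟩ := exists_free_hom (Cover.e 0 : Cover w k l) (Cover.e 1)
    have hT : ∀ y ∈ T, g y ∈ Cover.topIdeal w k l p := by
      have : T ≤ LieIdeal.comap hg.toLieHom (Cover.topIdeal w k l p) := by
        refine sup_le (LieSubmodule.lieSpan_le.2 ?_) ?_
        · have hw (i) : g (word ga gb i) = Cover.e i := by rw [hg.map_word, hga, hgb, Cover.word_e]
          have h3 : g ba3 = Cover.e 4 := hw 4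
          have h5 : g ba5 = Cover.e 6 := hw 6
          have h2 : g ⁅gb, ga⁆ = Cover.e 2 := hw 2
          have h1 : g bab = ⁅(Cover.e 2 : Cover w k l), (Cover.e 1 : Cover w k l)⁆ := by
            rw [← h2, ← hgb, ← hg]; rfl
          have h4 : g ba3b = ⁅(Cover.e 4 : Cover w k l), (Cover.e 1 : Cover w k l)⁆ := by
            rw [← h3, ← hgb, ← hg]; rfl
          rintro y ((rfl | rfl) | (rfl | rfl)) <;> refine LieIdeal.mem_comap.2 ?_
          · change g _ ∈ _
            rw [map_sub, map_sub, map_zsmul, h1, h3, h5]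
            intro i hi
            fin_cases i <;> simp at hi ⊢
          · change g _ ∈ _
            rw [map_sub, h4, h5]
            intro i hi
            fin_cases i <;> simp at hi ⊢
          · change g _ ∈ _
            rw [map_nsmul]
            intro i hi
            simp
          · change g _ ∈ _
            rw [map_nsmul]
            intro i hi
            simp
        · intro y hy
          refine LieIdeal.mem_comap.2 ?_
          have := Cover.lowerCentralSeries_le_fil 5 (hg.map_mem_lowerCentralSeries hy)
          intro i hi
          exact (Cover.mem_fil.1 this i hi) ▸ dvd_zero _
      exact fun y hy ↦ this hy
    have hy : g (∑ i, x i • word ga gb i) = x := by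
      rw [map_sum]
      conv_rhs => rw [← Cover.sum_smul_e x]
      refine Finset.sum_congr rfl fun i _ ↦ ?_
      rw [map_zsmul, hg.map_word, hga, hgb, Cover.word_e]
    rw [← hy]
    refine hT _ (idealMk_eq_zero.1 ?_)
    change q _ = 0
    rw [← hx, hθs, map_sum]
    refine Finset.sum_congr rfl fun i _ ↦ ?_
    rw [map_zsmul, hq.map_word]
  · rw [hθs]
    refine Finset.sum_eq_zero fun i _ ↦ ?_
    by_cases hi : i.val ≤ 6
    · obtain ⟨c, hc⟩ := hx i hi
      rw [hc, mul_comm, mul_smul]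
      convert smul_zero c
      fin_cases i
      · exact (natCast_zsmul _ _).trans hr3
      · exact (natCast_zsmul _ _).trans hr4
      · exact hC.tors
      · exact hC.tors3
      · exact hC.tors4
      · exact hC.tors5
      · exact hC.tors6
      · simp at hi
    · obtain rfl : i = 7 := by omega
      rw [hw7, smul_zero]

/-- `L` is the quotient of `Cover w k l` by the relations `p cᵢ = 0`, `p a = m c₇`,
`p b = n c₇`. -/
def IsPres (p : ℕ) (w k l m n : ℤ) (L : Type*) [LieRing L] : Prop :=
  ∃ ψ : Cover w k l →+ L, IsLieHom ψ ∧ Function.Surjective ψ ∧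
    ∀ x, ψ x = 0 ↔ x ∈ Cover.relIdeal w k l p m n

namespace Cover

variable {w k l : ℤ} {p : ℕ} {m n : ℤ}

lemma smul_e7_mem_relIdeal (hp : p.Prime) {t : ℤ} :
    t • e 7 ∈ relIdeal w k l p m n ↔ (p : ℤ) ∣ t := by
  rw [mem_relIdeal]
  constructor
  · rintro ⟨⟨i, j, h0, h1, h7⟩, -⟩
    obtain rfl : i = 0 := by simpa [hp.ne_zero] using h0
    obtain rfl : j = 0 := by simpa [hp.ne_zero] using h1
    simpa using h7
  · intro h
    exact ⟨⟨0, 0, by simpa using h⟩, by simp⟩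

lemma mem_topIdeal_of_sub_mem {x y : Cover w k l}
    (hy : y ∈ LieModule.lowerCentralSeries ℤ (Cover w k l) (Cover w k l) 6)
    (h : x - y ∈ relIdeal w k l p m n) : x ∈ topIdeal w k l p := by
  have hy' := mem_fil.1 (lowerCentralSeries_le_fil 5 hy)
  obtain ⟨⟨i, j, h0, h1, -⟩, h2, h3, h4, h5, h6⟩ := h
  have key (i : Fin 8) (hi : i.val ≤ 6) (h : (p : ℤ) ∣ (x - y) i) : (p : ℤ) ∣ x i := by
    simpa [hy' i hi] using h
  intro i hi
  refine key i hi ?_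
  fin_cases i
  exacts [⟨_, h0⟩, ⟨_, h1⟩, h2, h3, h4, h5, h6, by simp at hi]

lemma exists_sub_mem_of_mem_topIdeal {x : Cover w k l} (hx : x ∈ topIdeal w k l p) (m n : ℤ) :
    ∃ t : ℤ, x - t • e 7 ∈ relIdeal w k l p m n := by
  obtain ⟨i, hi⟩ := hx 0 (by simp)
  obtain ⟨j, hj⟩ := hx 1 (by simp)
  refine ⟨x 7 + i * m + j * n, ⟨i, j, by simp [hi], by simp [hj], 0, ?_⟩, ?_⟩
  · simp
    ring
  · have h2 := hx 2 (by simp)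
    have h3 := hx 3 (by simp)
    have h4 := hx 4 (by simp)
    have h5 := hx 5 (by simp)
    have h6 := hx 6 (by simp)
    simp [h2, h3, h4, h5, h6]

/-- The representatives modulo `relIdeal`. -/
def rep (t : Fin 8 → Fin p) : Cover w k l := of fun i ↦ ((t i : ℕ) : ℤ)

lemma exists_sub_rep_mem (hp : p.Prime) (m n : ℤ) (x : Cover w k l) :
    ∃ t : Fin 8 → Fin p, x - rep t ∈ relIdeal w k l p m n := by
  have key (z : ℤ) : ∃ t : Fin p, (p : ℤ) ∣ z - (t : ℕ) := by
    have hp0 : (p : ℤ) ≠ 0 := by exact_mod_cast hp.ne_zero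
    have h1 := Int.emod_nonneg z hp0
    have h2 := Int.emod_lt_of_pos z (by exact_mod_cast hp.pos : (0 : ℤ) < p)
    refine ⟨⟨(z % p).toNat, by omega⟩, ?_⟩
    simp only [Int.toNat_of_nonneg h1]
    exact Int.dvd_self_sub_emod
  obtain ⟨t0, i, h0⟩ := key (x 0)
  obtain ⟨t1, j, h1⟩ := key (x 1)
  obtain ⟨t2, h2⟩ := key (x 2)
  obtain ⟨t3, h3⟩ := key (x 3)
  obtain ⟨t4, h4⟩ := key (x 4)
  obtain ⟨t5, h5⟩ := key (x 5)
  obtain ⟨t6, h6⟩ := key (x 6)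
  obtain ⟨t7, h7⟩ := key (x 7 + i * m + j * n)
  refine ⟨![t0, t1, t2, t3, t4, t5, t6, t7], ⟨i, j, h0, h1, ?_⟩, h2, h3, h4, h5, h6⟩
  convert h7 using 1
  change x 7 - t7 + _ + _ = _
  ring

lemma rep_injective_mod (hp : p.Prime) {t t' : Fin 8 → Fin p}
    (h : (rep t : Cover w k l) - rep t' ∈ relIdeal w k l p m n) : t = t' := by
  have key (a b : Fin p) (h : (p : ℤ) ∣ (a : ℕ) - (b : ℕ)) : a = b := by
    have := (Int.natCast_modEq_iff.1 (Int.modEq_iff_dvd.2 h)).eq_of_lt_of_lt b.2 a.2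
    exact Fin.ext this.symm
  obtain ⟨⟨i, j, h0, h1, h7⟩, h2, h3, h4, h5, h6⟩ := h
  change ((t 0 : ℕ) : ℤ) - (t' 0 : ℕ) = _ at h0
  change ((t 1 : ℕ) : ℤ) - (t' 1 : ℕ) = _ at h1
  have e0 := key _ _ ⟨i, h0⟩
  have e1 := key _ _ ⟨j, h1⟩
  obtain rfl : i = 0 := by simpa [e0, hp.ne_zero] using h0
  obtain rfl : j = 0 := by simpa [e1, hp.ne_zero] using h1
  funext i
  fin_cases i
  · exact e0
  · exact e1
  · exact key _ _ h2
  · exact key _ _ h3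
  · exact key _ _ h4
  · exact key _ _ h5
  · exact key _ _ h6
  · exact key _ _ (by simpa [rep] using h7)

lemma card_quotient_relIdeal (hp : p.Prime) :
    Nat.card (Cover w k l ⧸ relIdeal w k l p m n) = p ^ 8 := by
  have : Function.Bijective fun t : Fin 8 → Fin p ↦ idealMk (relIdeal w k l p m n) (rep t) := by
    refine ⟨fun t t' h ↦ ?_, fun y ↦ ?_⟩
    · refine rep_injective_mod (m := m) (n := n) hp (w := w) (k := k) (l := l)
        (idealMk_eq_zero.1 ?_)
      rw [map_sub, sub_eq_zero]
      exact h
    · obtain ⟨x, rfl⟩ := idealMk_surjective _ y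
      obtain ⟨t, ht⟩ := exists_sub_rep_mem hp m n x
      refine ⟨t, ?_⟩
      rw [← idealMk_eq_zero, map_sub, sub_eq_zero] at ht
      exact ht.symm
  rw [← Nat.card_eq_of_bijective _ this]
  simp

end Cover

section IsPres

variable {w k l : ℤ} {p : ℕ} {m n : ℤ} {L : Type*} [LieRing L]

lemma isPres_quotient : IsPres p w k l m n (Cover w k l ⧸ Cover.relIdeal w k l p m n) :=
  ⟨idealMk _, isLieHom_idealMk _, idealMk_surjective _, fun _ ↦ idealMk_eq_zero⟩

lemma IsPres.of_card (hp : p.Prime) (hL : Nat.card L = p ^ 8) {ψ : Cover w k l →+ L}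
    (hψ : IsLieHom ψ) (hs : Function.Surjective ψ)
    (h : ∀ x ∈ Cover.relIdeal w k l p m n, ψ x = 0) : IsPres p w k l m n L := by
  have : Finite L := Nat.finite_of_card_ne_zero (by rw [hL]; exact pow_ne_zero _ hp.ne_zero)
  have hrep (x) : ∃ t : Fin 8 → Fin p, x - Cover.rep t ∈ Cover.relIdeal w k l p m n ∧
      ψ x = ψ (Cover.rep t) := by
    obtain ⟨t, ht⟩ := Cover.exists_sub_rep_mem hp m n x
    exact ⟨t, ht, by rw [← sub_eq_zero, ← map_sub, h _ ht]⟩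
  have hs' : Function.Surjective fun t : Fin 8 → Fin p ↦ ψ (Cover.rep t) := fun y ↦ by
    obtain ⟨x, rfl⟩ := hs y
    obtain ⟨t, -, ht⟩ := hrep x
    exact ⟨t, ht.symm⟩
  have hb := hs'.bijective_of_nat_card_le (by rw [hL]; simp)
  refine ⟨ψ, hψ, hs, fun x ↦ ⟨fun hx ↦ ?_, h x⟩⟩
  obtain ⟨t, ht, ht'⟩ := hrep x
  obtain ⟨t₀, h₀, h₀'⟩ := hrep 0
  obtain rfl : t = t₀ := hb.1 (by simp only [← ht', ← h₀', hx, map_zero])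
  simpa using sub_mem ht h₀

lemma IsPres.isLieIso {L' : Type*} [LieRing L'] (h : IsPres p w k l m n L)
    (h' : IsPres p w k l m n L') : IsLieIso L L' := by
  obtain ⟨f, hf, hfs, hf'⟩ := h
  obtain ⟨g, hg, hgs, hg'⟩ := h'
  exact isLieIso_of_ker_eq hf hg hfs hgs fun x ↦ (hf' x).trans (hg' x).symm

lemma IsPres.of_isLieIso {L' : Type*} [LieRing L'] (h : IsPres p w k l m n L)
    (e : IsLieIso L L') : IsPres p w k l m n L' := by
  obtain ⟨f, hf, hfs, hf'⟩ := h
  obtain ⟨g, hg, hgb⟩ := e.exists_hom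
  refine ⟨g.comp f, hg.comp hf, hgb.2.comp hfs, fun x ↦ ?_⟩
  rw [← hf', AddMonoidHom.comp_apply, map_eq_zero_iff g hgb.1]

lemma IsPres.lieClassEq (hp : p.Prime) (h : IsPres p w k l m n L) : LieClassEq L 7 := by
  obtain ⟨ψ, hψ, hs, hk⟩ := h
  constructor
  · rw [eq_bot_iff]
    intro y hy
    obtain ⟨x, hx, rfl⟩ := hψ.exists_mem_lowerCentralSeries hs hy
    have := Cover.mem_fil.1 (Cover.lowerCentralSeries_le_fil 6 hx)
    obtain rfl : x = 0 := funext fun i ↦ this i (by omega)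
    simp
  · intro hbot
    have h7 := word_mem_lowerCentralSeries (ψ (Cover.e 0)) (ψ (Cover.e 1)) 6 (by simp)
    rw [← hψ.map_word, Cover.word_e] at h7
    have : ψ (Cover.e 7) = 0 := by
      have h7' : ψ (Cover.e 7) ∈ LieModule.lowerCentralSeries ℤ L L (7 - 1) := h7
      rwa [hbot] at h7'
    rw [hk, ← one_smul ℤ (Cover.e 7), Cover.smul_e7_mem_relIdeal hp] at this
    exact hp.one_lt.ne' (by exact_mod_cast Int.eq_one_of_dvd_one (by simp) this)

lemma IsPres.isLieIso_quotient (hp : Odd p) (h : IsPres p w k l m n L) :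
    IsLieIso (L ⧸ LieModule.lowerCentralSeries ℤ L L 6) (presLie p (relators w)) := by
  obtain ⟨ψ, hψ, hs, hk⟩ := h
  obtain ⟨θ, hθ, hθs, hθk⟩ := exists_hom_presLie p hp w k l
  refine isLieIso_of_ker_eq ((isLieHom_idealMk _).comp hψ) hθ ((idealMk_surjective _).comp hs) hθs
    fun x ↦ ?_
  rw [hθk, AddMonoidHom.comp_apply, idealMk_eq_zero]
  constructor
  · intro hx
    obtain ⟨y, hy, hxy⟩ := hψ.exists_mem_lowerCentralSeries hs hx
    refine Cover.mem_topIdeal_of_sub_mem (m := m) (n := n) hy ?_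
    rw [← hk, map_sub, hxy, sub_self]
  · intro hx
    obtain ⟨t, ht⟩ := Cover.exists_sub_mem_of_mem_topIdeal hx m n
    rw [← hk, map_sub, sub_eq_zero, map_zsmul, ← Cover.word_e, hψ.map_word] at ht
    rw [ht]
    exact (LieModule.lowerCentralSeries ℤ L L 6).smul_mem t
      (word_mem_lowerCentralSeries _ _ 6 (by simp))

end IsPres

section Existence

variable {L : Type*} [LieRing L]

/-- The Lie ideal of multiples of a central element. -/
def zmultiplesIdeal (z : L) (hz : ∀ x : L, ⁅x, z⁆ = 0) : LieIdeal ℤ L where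
  carrier := {x | ∃ t : ℤ, x = t • z}
  add_mem' := by
    rintro _ _ ⟨s, rfl⟩ ⟨t, rfl⟩
    exact ⟨s + t, (add_smul _ _ _).symm⟩
  zero_mem' := ⟨0, (zero_smul _ _).symm⟩
  smul_mem' := by
    rintro c _ ⟨t, rfl⟩
    exact ⟨c * t, smul_smul _ _ _⟩
  lie_mem := by
    rintro x _ ⟨t, rfl⟩
    exact ⟨0, by rw [lie_zsmul, hz, smul_zero, zero_smul]⟩

lemma exists_isPres {p : ℕ} (hp : p.Prime) (hodd : Odd p) (w : ℤ) (hcard : Nat.card L = p ^ 8)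
    (hcl : LieClassEq L 7)
    (hiso : IsLieIso (L ⧸ LieModule.lowerCentralSeries ℤ L L 6) (presLie p (relators w))) :
    ∃ k l m n, IsPres p w k l m n L := by
  obtain ⟨f, hf, hfb⟩ := hiso.exists_hom
  obtain ⟨θ, hθ, hθs, hθk⟩ := exists_hom_presLie p hodd w 0 0
  let q := f.comp (idealMk (LieModule.lowerCentralSeries ℤ L L 6))
  have hq : IsLieHom q := hf.comp (isLieHom_idealMk _)
  have hqs : Function.Surjective q := hfb.2.comp (idealMk_surjective _)
  have hqk (x) : q x = 0 ↔ x ∈ LieModule.lowerCentralSeries ℤ L L 6 := by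
    rw [← idealMk_eq_zero, ← map_eq_zero_iff f hfb.1]
    rfl
  obtain ⟨a, ha⟩ := hqs (θ (Cover.e 0))
  obtain ⟨b, hb⟩ := hqs (θ (Cover.e 1))
  have hv (i) : q (word a b i) = θ (Cover.e i) := by
    rw [hq.map_word, ha, hb, ← hθ.map_word, Cover.word_e]
  have hcent {x : L} (hx : x ∈ LieModule.lowerCentralSeries ℤ L L 6) (y : L) : ⁅x, y⁆ = 0 :=
    lie_eq_zero_of_mem (j := 6) hcl.1 hx y
  obtain ⟨X, hX⟩ : ∃ X, X = ⁅word a b 2, b⁆ - word a b 4 - w • word a b 6 := ⟨_, rfl⟩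
  obtain ⟨Y, hY⟩ : ∃ Y, Y = ⁅word a b 4, b⁆ - word a b 6 := ⟨_, rfl⟩
  have hX6 : X ∈ LieModule.lowerCentralSeries ℤ L L 6 := by
    rw [← hqk, hX, map_sub, map_sub, map_zsmul, hq, hv, hv, hv, hb, ← hθ, ← map_zsmul, ← map_sub,
      ← map_sub, hθk]
    intro i hi
    fin_cases i <;> simp
  have hY6 : Y ∈ LieModule.lowerCentralSeries ℤ L L 6 := by
    rw [← hqk, hY, map_sub, hq, hv, hv, hb, ← hθ, ← map_sub, hθk]
    intro i hi
    fin_cases i <;> simp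
  have hpa : (p : ℤ) • a ∈ LieModule.lowerCentralSeries ℤ L L 6 := by
    rw [← hqk, map_zsmul, ha, ← map_zsmul, hθk]
    exact fun i _ ↦ dvd_mul_right _ _
  have hpb : (p : ℤ) • b ∈ LieModule.lowerCentralSeries ℤ L L 6 := by
    rw [← hqk, map_zsmul, hb, ← map_zsmul, hθk]
    exact fun i _ ↦ dvd_mul_right _ _
  have hC : CoverRel p w (word a b) X Y :=
    CoverRel.of_word (by rw [hX]; abel) (by rw [hY]; abel) (hcent hX6) (hcent hY6) hcl.1
      (hcent hpb)
  have hsum (z : Cover w 0 0) : q (∑ i, z i • word a b i) = θ z := by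
    rw [Cover.map_eq_sum hθ, map_sum, ← ha, ← hb]
    refine Finset.sum_congr rfl fun i _ ↦ ?_
    rw [map_zsmul, hq.map_word]
  have hdecomp (x : L) : ∃ z : Cover w 0 0,
      x - ∑ i, z i • word a b i ∈ LieModule.lowerCentralSeries ℤ L L 6 := by
    obtain ⟨z, hz⟩ := hθs (q x)
    exact ⟨z, by rw [← hqk, map_sub, hsum, hz, sub_self]⟩
  have h6 (x : L) : ∃ t : ℤ, ⁅word a b 6, x⁆ = t • word a b 7 := by
    obtain ⟨z, hz⟩ := hdecomp x
    refine ⟨z 0, ?_⟩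
    rw [← sub_add_cancel x (∑ i, z i • word a b i), lie_add, ← lie_skew _ (x - _), hcent hz,
      Fin.sum_univ_eight]
    simp only [lie_add, lie_zsmul, hC.e7, hC.b61 hodd, hC.b62, hC.b63, hC.b64, hC.b65, lie_self,
      ← lie_skew _ (word a b 7), hC.h7]
    simp
  have h7 {x : L} (hx : x ∈ LieModule.lowerCentralSeries ℤ L L 6) :
      ∃ t : ℤ, x = t • word a b 7 := by
    have hle : LieModule.lowerCentralSeries ℤ L L 6 ≤ zmultiplesIdeal (word a b 7)
        fun x ↦ by rw [← lie_skew, hC.h7, neg_zero] := by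
      rw [LieModule.lowerCentralSeries_succ, LieSubmodule.lie_le_iff]
      intro x _ y hy
      obtain ⟨z, hz, hzy⟩ := hθ.exists_mem_lowerCentralSeries hθs (hq.map_mem_lowerCentralSeries hy)
      have hz' := Cover.mem_fil.1 (Cover.lowerCentralSeries_le_fil 4 hz)
      have hy' : y - ∑ i, z i • word a b i ∈ LieModule.lowerCentralSeries ℤ L L 6 := by
        rw [← hqk, map_sub, hsum, hzy, sub_self]
      obtain ⟨t, ht⟩ := h6 x
      refine ⟨-(z 6 * t), ?_⟩
      rw [← lie_skew, ← sub_add_cancel y (∑ i, z i • word a b i), add_lie, hcent hy',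
        Fin.sum_univ_eight, hz' 0 (by simp), hz' 1 (by simp), hz' 2 (by simp), hz' 3 (by simp),
        hz' 4 (by simp), hz' 5 (by simp)]
      simp only [zero_smul, zero_add, add_lie, zsmul_lie, ht, hC.h7, smul_zero, add_zero, neg_smul,
        mul_smul]
    exact hle hx
  obtain ⟨k, rfl⟩ := h7 hX6
  obtain ⟨l, rfl⟩ := h7 hY6
  obtain ⟨m, hm⟩ := h7 hpa
  obtain ⟨n, hn⟩ := h7 hpb
  let F := hC.toHom hodd
  let ψ : Cover w k l →+ L := AddMonoidHom.mk' F (map_add F)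
  have hψ (x) : ψ x = ∑ i, x i • word a b i := hC.toHom_apply hodd x
  refine ⟨k, l, m, n, IsPres.of_card hp hcard (ψ := ψ) (fun x y ↦ LieHom.map_lie F x y)
    (fun y ↦ ?_) fun x hx ↦ ?_⟩
  · obtain ⟨z, hz⟩ := hdecomp y
    obtain ⟨t, ht⟩ := h7 hz
    refine ⟨Cover.of z + t • Cover.e 7, ?_⟩
    rw [map_add, map_zsmul, hψ, hψ (Cover.e 7), sub_eq_iff_eq_add'.1 ht]
    simp
    rfl
  · obtain ⟨⟨i, j, h0, h1, d, h7⟩, ⟨a2, h2⟩, ⟨a3, h3⟩, ⟨a4, h4⟩, ⟨a5, h5⟩, ⟨a6, h6⟩⟩ := hx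
    have e0 : (i * (p : ℤ)) • word a b 0 = (i * m) • word a b 7 := by
      rw [mul_smul, mul_smul, ← hm]
      rfl
    have e1 : (j * (p : ℤ)) • word a b 1 = (j * n) • word a b 7 := by
      rw [mul_smul, mul_smul, ← hn]
      rfl
    have e7 : x 7 = d * p - i * m - j * n := by linear_combination h7
    rw [hψ, Fin.sum_univ_eight, h0, h1, h2, h3, h4, h5, h6, e7, mul_comm _ i, mul_comm _ j,
      mul_comm _ a2, mul_comm _ a3, mul_comm _ a4, mul_comm _ a5, mul_comm _ a6, e0, e1,
      mul_smul a2, mul_smul a3, mul_smul a4, mul_smul a5, mul_smul a6, hC.tors, hC.tors3, hC.tors4,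
      hC.tors5, hC.tors6,
      sub_smul, sub_smul, mul_smul d, hC.tors7]
    simp

end Existence

/-- The relation between the parameters of isomorphic descendants, arising from the change of
generators `a ↦ ±a`, `b ↦ b + g c₃`. -/
def ParamRel (p : ℕ) (k l m n k' l' m' n' : ℤ) : Prop :=
  ∃ ε f : ℤ, (ε = 1 ∨ ε = -1) ∧ k' ≡ ε * k + f * l [ZMOD p] ∧ l' ≡ ε * l [ZMOD p] ∧
    m' ≡ ε * m [ZMOD p] ∧ n' ≡ n [ZMOD p]

namespace Cover

variable {w k l : ℤ} {p : ℕ} {m n : ℤ}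

lemma word_twist {ε : ℤ} (hε : ε = 1 ∨ ε = -1) (g : ℤ) (i : Fin 8) :
    word (ε • e 0 : Cover w k l) (e 1 + g • e 3) i =
      ![ε • e 0, e 1 + g • e 3, ε • (e 2 + g • e 4), e 3 + g • e 5, ε • (e 4 + g • e 6),
        e 5 + g • e 7, ε • e 6, e 7] i := by
  have h2 : ⁅(e 1 + g • e 3 : Cover w k l), (ε • e 0 : Cover w k l)⁆ = ε • (e 2 + g • e 4) := by
    apply ext8 <;> simp [mul_comm]
  have h3 : ⁅(ε • (e 2 + g • e 4) : Cover w k l), (ε • e 0 : Cover w k l)⁆ = e 3 + g • e 5 := by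
    rcases hε with rfl | rfl <;> apply ext8 <;> simp
  have h4 : ⁅(e 3 + g • e 5 : Cover w k l), (ε • e 0 : Cover w k l)⁆ = ε • (e 4 + g • e 6) := by
    apply ext8 <;> simp [mul_comm]
  have h5 : ⁅(ε • (e 4 + g • e 6) : Cover w k l), (ε • e 0 : Cover w k l)⁆ = e 5 + g • e 7 := by
    rcases hε with rfl | rfl <;> apply ext8 <;> simp
  have h6 : ⁅(e 5 + g • e 7 : Cover w k l), (ε • e 0 : Cover w k l)⁆ = ε • e 6 := by
    apply ext8 <;> simp
  have h7 : ⁅(ε • e 6 : Cover w k l), (ε • e 0 : Cover w k l)⁆ = e 7 := by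
    rcases hε with rfl | rfl <;> apply ext8 <;> simp
  change ![_, _, _, _, _, _, _, _] i = _
  rw [h2, h3, h4, h5, h6, h7]

end Cover

lemma IsPres.of_paramRel {p : ℕ} (hp : p.Prime) (hodd : Odd p) {w k l m n k' l' m' n' : ℤ}
    {L : Type*} [LieRing L] (hL : Nat.card L = p ^ 8) (h : IsPres p w k l m n L)
    (hrel : ParamRel p k l m n k' l' m' n') : IsPres p w k' l' m' n' L := by
  obtain ⟨ε, f, hε, hk', hl', hm', hn'⟩ := hrel
  have hcl := h.lieClassEq hp
  obtain ⟨ψ, hψ, hs, hk⟩ := h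
  obtain ⟨g, hg⟩ : ∃ g : ℤ, ε * f ≡ 2 * g [ZMOD p] := by
    obtain ⟨q, rfl⟩ := hodd
    refine ⟨ε * f * (q + 1), (Int.modEq_iff_dvd).2 ⟨ε * f, ?_⟩⟩
    push_cast
    ring
  have hεε : ε * ε = 1 := by rcases hε with rfl | rfl <;> rfl
  have hk'' : k' ≡ ε * k + 2 * (ε * g) * l [ZMOD p] := by
    refine hk'.trans (Int.ModEq.add_left _ (Int.ModEq.mul_right _ ?_))
    have := hg.mul_left ε
    rw [← mul_assoc, hεε, one_mul] at this
    exact this.trans (by rw [mul_left_comm])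
  let A : Cover w k l := ε • Cover.e 0
  let B : Cover w k l := Cover.e 1 + g • Cover.e 3
  have hw (i) : word (ψ A) (ψ B) i = ψ (word A B i) := (hψ.map_word A B i).symm
  have hcent (x : L) : ⁅word (ψ A) (ψ B) 7, x⁆ = 0 :=
    lie_eq_zero_of_mem (j := 6) hcl.1 (word_mem_lowerCentralSeries _ _ 6 (by simp)) x
  have hC : CoverRel p w (word (ψ A) (ψ B)) (k' • word (ψ A) (ψ B) 7)
      (l' • word (ψ A) (ψ B) 7) := by
    refine CoverRel.of_word ?_ ?_ ?_ ?_ hcl.1 ?_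
    · rw [hw, hw, hw, hw, ← hψ, ← map_zsmul, ← map_zsmul, ← map_add, ← map_add, ← sub_eq_zero,
        ← map_sub, hk, Cover.word_twist hε, Cover.word_twist hε, Cover.word_twist hε,
        Cover.word_twist hε]
      refine ⟨⟨0, 0, ?_, ?_, ?_⟩, ?_, ?_, ?_, ?_, ?_⟩
      · simp [B]
      · simp [B]
      · convert (Int.modEq_iff_dvd.1 hk'') using 1
        simp [B]
        ring
      · simp [B]
      · simp [B]
      · simp [B]
      · simp [B]
      · simp [B]
        ring_nf
        exact dvd_zero _
    · rw [hw, hw, hw, ← hψ, ← map_zsmul, ← map_add, ← sub_eq_zero,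
        ← map_sub, hk, Cover.word_twist hε, Cover.word_twist hε, Cover.word_twist hε]
      refine ⟨⟨0, 0, ?_, ?_, ?_⟩, ?_, ?_, ?_, ?_, ?_⟩
      · simp [B]
      · simp [B]
      · convert (Int.modEq_iff_dvd.1 hl') using 1
        simp [B]
      · simp [B]
      · simp [B]
      · simp [B]
      · simp [B]
      · simp [B]
    · intro x
      rw [zsmul_lie, hcent, smul_zero]
    · intro x
      rw [zsmul_lie, hcent, smul_zero]
    · intro x
      have : (p : ℤ) • ψ B = n • word (ψ A) (ψ B) 7 := by
        rw [hw, ← map_zsmul, ← map_zsmul, ← sub_eq_zero, ← map_sub, hk, Cover.word_twist hε]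
        refine ⟨⟨0, 1, ?_, ?_, ?_⟩, ?_, ?_, ?_, ?_, ?_⟩ <;> simp [B]
      rw [this, zsmul_lie, hcent, smul_zero]
  let F := hC.toHom hodd
  let ψ' : Cover w k' l' →+ L := AddMonoidHom.mk' F (map_add F)
  let T (x : Cover w k' l') : Cover w k l := Cover.of ![ε * x 0, x 1, ε * x 2, x 3 + g * x 1,
    ε * (x 4 + g * x 2), x 5 + g * x 3, ε * (x 6 + g * x 4), x 7 + g * x 5]
  have hψ' (x) : ψ' x = ψ (T x) := by
    refine (hC.toHom_apply hodd x).trans ?_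
    have hT : T x = ∑ i, x i • word A B i := by
      simp only [A, B, Cover.word_twist hε, Fin.sum_univ_eight]
      apply Cover.ext8 <;> simp [T] <;> ring
    rw [hT, map_sum]
    exact Finset.sum_congr rfl fun i _ ↦ by rw [hw, map_zsmul]
  refine IsPres.of_card hp hL (ψ := ψ') (fun x y ↦ LieHom.map_lie F x y) (fun y ↦ ?_)
    fun x hx ↦ ?_
  · obtain ⟨x, rfl⟩ := hs y
    let x3 := x 3 - g * x 1
    let x4 := ε * (x 4 - g * x 2)
    let x5 := x 5 - g * x3
    refine ⟨Cover.of ![ε * x 0, x 1, ε * x 2, x3, x4, x5, ε * x 6 - g * x4, x 7 - g * x5], ?_⟩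
    rw [hψ']
    congr 1
    rcases hε with rfl | rfl <;> apply Cover.ext8 <;> simp [T, x3, x4, x5]
  · rw [hψ', hk]
    obtain ⟨⟨i, j, h0, h1, h7⟩, h2, h3, h4, h5, h6⟩ := hx
    have h1' : (p : ℤ) ∣ x 1 := ⟨j, h1⟩
    refine ⟨⟨ε * i, j, ?_, h1, ?_⟩, h2.mul_left ε, h3.add (h1'.mul_left g),
      (h4.add (h2.mul_left g)).mul_left ε, h5.add (h3.mul_left g),
      (h6.add (h4.mul_left g)).mul_left ε⟩
    · change ε * x 0 = _
      rw [h0]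
      ring
    · change _ ∣ (x 7 + g * x 5) + _ + _
      have := ((h7.add (h5.mul_left g)).add ((Int.modEq_iff_dvd.1 hm').mul_left i)).add
        ((Int.modEq_iff_dvd.1 hn').mul_left j)
      have e : x 7 + g * x 5 + ε * i * m + j * n = x 7 + i * m' + j * n' + g * x 5 +
        i * (ε * m - m') + j * (n - n') := by ring
      rw [e]
      exact this

/-- The coefficient comparison behind the classification: `r, s, t, u` are the coefficients of
`a, b` in the images of the generators, and `xᵢ` are the remaining coefficients involved. -/
lemma coefficients_eq {K : Type*} [Field K] (h2 : (2 : K) ≠ 0)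
    {w k l k' l' r s t u D A2 B2 B3 c23 c24 c25 c26 : K} (hw : w ≠ 0)
    (hD : D = u * r - t * s) (hδ : D * r ^ 5 ≠ 0) (h23 : c23 = B2 * r - t * A2)
    (r13 : D * t = 0)
    (r14 : c23 * t + D * u - D * r * r = 0)
    (r15 : c24 * t + c23 * u - ((c23 * r + D * s) * r + D * r * s) = 0)
    (r16 : c25 * t + c24 * u + w * (D * u) - ((c24 * r + c23 * s) * r + (c23 * r + D * s) * s) -
      w * (D * r ^ 4) = 0)
    (r17 : c26 * t + c25 * u + w * (c23 * u) + k * (D * u) + l * (c24 * u) -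
      l * (c23 * B2 - D * B3) - ((c25 * r + c24 * s + w * (D * s)) * r + (c24 * r + c23 * s) * s +
        w * (D * r * s) + l * ((c23 * r + D * s) * s) - l * (D * r * A2)) -
      w * ((((c23 * r + D * s) * r + D * r * s) * r + D * r * r * s) * r + D * r * r * r * s) -
      k' * (D * r ^ 5) = 0)
    (r27 : ((c24 * r + c23 * s) * r + (c23 * r + D * s) * s) * t +
      ((c23 * r + D * s) * r + D * r * s) * u + l * (D * r * r * u) -
      ((((c23 * r + D * s) * r + D * r * s) * r + D * r * r * s) * r + D * r * r * r * s) -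
      l' * (D * r ^ 5) = 0) :
    r ^ 2 = 1 ∧ s = 0 ∧ t = 0 ∧ u = 1 ∧ l' = r * l ∧ ∃ f, k' = r * k + f * l := by
  have hr : r ≠ 0 := by
    rintro rfl
    simp at hδ
  have hD0 : D ≠ 0 := left_ne_zero_of_mul hδ
  obtain rfl : t = 0 := by simpa [hD0] using r13
  have hu : u = r ^ 2 := by
    refine mul_left_cancel₀ hD0 ?_
    linear_combination r14
  subst hu
  obtain rfl : s = 0 := by
    have : 2 * D * r * s = 0 := by linear_combination -r15
    simpa [h2, hD0, hr] using this
  have hr2 : r ^ 2 = 1 := by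
    have : w * D * r ^ 2 * (1 - r ^ 2) = 0 := by linear_combination r16
    have : 1 - r ^ 2 = 0 := by simpa [hw, hD0, hr] using this
    linear_combination -this
  have hDr : D = r := by linear_combination hD + r * hr2
  subst hDr
  refine ⟨hr2, rfl, rfl, hr2, ?_, c24 - c23 * B2 + D * B3 + A2, ?_⟩
  · linear_combination (-l' * (D ^ 4 + D ^ 2 + 1) + l * D * (D ^ 2 + 1)) * hr2 - r27
  · linear_combination
      (-k' * (D ^ 4 + D ^ 2 + 1) - w * c23 * D ^ 2 + k * D + l * c24 + l * A2) * hr2 - r17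

lemma IsPres.paramRel {p : ℕ} (hp : p.Prime) (h5 : 5 ≤ p) {w k l m n k' l' m' n' : ℤ}
    (hw : (w : ZMod p) ≠ 0) {L : Type*} [LieRing L] (h : IsPres p w k l m n L)
    (h' : IsPres p w k' l' m' n' L) : ParamRel p k l m n k' l' m' n' := by
  have : Fact p.Prime := ⟨hp⟩
  obtain ⟨ψ, hψ, hs, hk⟩ := h
  obtain ⟨ψ', hψ', hs', hk'⟩ := h'
  obtain ⟨A, hA⟩ := hs (ψ' (Cover.e 0))
  obtain ⟨B, hB⟩ := hs (ψ' (Cover.e 1))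
  have hv (i) : ψ (word A B i) = ψ' (Cover.e i) := by
    rw [hψ.map_word, hA, hB, ← hψ'.map_word, Cover.word_e]
  have R1 : ⁅word A B 2, B⁆ - word A B 4 - w • word A B 6 - k' • word A B 7 ∈
      Cover.relIdeal w k l p m n := by
    rw [← hk, map_sub, map_sub, map_sub, map_zsmul, map_zsmul, hψ, hv, hv, hv, hv, hB, ← hψ',
      ← map_zsmul, ← map_zsmul, ← map_sub, ← map_sub, ← map_sub, hk']
    refine ⟨⟨0, 0, ?_, ?_, ?_⟩, ?_, ?_, ?_, ?_, ?_⟩ <;> simp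
  have R2 : ⁅word A B 4, B⁆ - word A B 6 - l' • word A B 7 ∈ Cover.relIdeal w k l p m n := by
    rw [← hk, map_sub, map_sub, map_zsmul, hψ, hv, hv, hv, hB, ← hψ', ← map_zsmul, ← map_sub,
      ← map_sub, hk']
    refine ⟨⟨0, 0, ?_, ?_, ?_⟩, ?_, ?_, ?_, ?_, ?_⟩ <;> simp
  have R3 : (p : ℤ) • A - m' • word A B 7 ∈ Cover.relIdeal w k l p m n := by
    rw [← hk, map_sub, map_zsmul, map_zsmul, hv, hA, ← map_zsmul, ← map_zsmul, ← map_sub, hk']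
    refine ⟨⟨1, 0, ?_, ?_, ?_⟩, ?_, ?_, ?_, ?_, ?_⟩ <;> simp
  have R4 : (p : ℤ) • B - n' • word A B 7 ∈ Cover.relIdeal w k l p m n := by
    rw [← hk, map_sub, map_zsmul, map_zsmul, hv, hB, ← map_zsmul, ← map_zsmul, ← map_sub, hk']
    refine ⟨⟨0, 1, ?_, ?_, ?_⟩, ?_, ?_, ?_, ?_, ?_⟩ <;> simp
  have N : word A B 7 ∉ Cover.relIdeal w k l p m n := by
    rw [← hk, hv, hk', ← one_smul ℤ (Cover.e 7), Cover.smul_e7_mem_relIdeal hp]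
    intro h
    exact hp.one_lt.ne' (by exact_mod_cast Int.eq_one_of_dvd_one (by simp) h)
  have e2 : word A B 2 = ⁅B, A⁆ := rfl
  have e3 : word A B 3 = ⁅word A B 2, A⁆ := rfl
  have e4 : word A B 4 = ⁅word A B 3, A⁆ := rfl
  have e5 : word A B 5 = ⁅word A B 4, A⁆ := rfl
  have e6 : word A B 6 = ⁅word A B 5, A⁆ := rfl
  have e7 : word A B 7 = ⁅word A B 6, A⁆ := rfl
  generalize word A B 2 = c2, word A B 3 = c3, word A B 4 = c4, word A B 5 = c5, word A B 6 = c6,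
    word A B 7 = c7 at *
  have c20 : c2 0 = 0 := by simp [e2]
  have c21 : c2 1 = 0 := by simp [e2]
  have c22 : c2 2 = B 1 * A 0 - B 0 * A 1 := by simp [e2]
  have c23 : c2 3 = B 2 * A 0 - B 0 * A 2 := by simp [e2]
  have c30 : c3 0 = 0 := by simp [e3]
  have c31 : c3 1 = 0 := by simp [e3]
  have c32 : c3 2 = 0 := by simp [e3, c20, c21]
  have c33 : c3 3 = c2 2 * A 0 := by simp [e3, c20]
  have c34 : c3 4 = c2 3 * A 0 + c2 2 * A 1 := by simp [e3, c20, c21]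
  have c35 : c3 5 = c2 4 * A 0 + c2 3 * A 1 := by simp [e3, c20, c21]
  have c36 : c3 6 = c2 5 * A 0 + c2 4 * A 1 + w * (c2 2 * A 1) := by simp [e3, c20, c21]
  have c40 : c4 0 = 0 := by simp [e4]
  have c41 : c4 1 = 0 := by simp [e4]
  have c42 : c4 2 = 0 := by simp [e4, c30, c31]
  have c43 : c4 3 = 0 := by simp [e4, c30, c32]
  have c44 : c4 4 = c3 3 * A 0 := by simp [e4, c30, c31, c32]
  have c45 : c4 5 = c3 4 * A 0 + c3 3 * A 1 := by simp [e4, c30, c31]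
  have c46 : c4 6 = c3 5 * A 0 + c3 4 * A 1 := by simp [e4, c30, c31, c32]
  have c47 : c4 7 = c3 6 * A 0 + c3 5 * A 1 + w * (c3 3 * A 1) + l * (c3 4 * A 1)
      - l * (c3 3 * A 2) := by simp [e4, c30, c31, c32]
  have c50 : c5 0 = 0 := by simp [e5]
  have c51 : c5 1 = 0 := by simp [e5]
  have c52 : c5 2 = 0 := by simp [e5, c40, c41]
  have c53 : c5 3 = 0 := by simp [e5, c40, c42]
  have c54 : c5 4 = 0 := by simp [e5, c40, c41, c42, c43]
  have c55 : c5 5 = c4 4 * A 0 := by simp [e5, c40, c41, c43]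
  have c56 : c5 6 = c4 5 * A 0 + c4 4 * A 1 := by simp [e5, c40, c41, c42]
  have c60 : c6 0 = 0 := by simp [e6]
  have c61 : c6 1 = 0 := by simp [e6]
  have c62 : c6 2 = 0 := by simp [e6, c50, c51]
  have c63 : c6 3 = 0 := by simp [e6, c50, c52]
  have c64 : c6 4 = 0 := by simp [e6, c50, c51, c52, c53]
  have c65 : c6 5 = 0 := by simp [e6, c50, c51, c53, c54]
  have c66 : c6 6 = c5 5 * A 0 := by simp [e6, c50, c51, c52, c54]
  have c67 : c6 7 = c5 6 * A 0 + c5 5 * A 1 := by simp [e6, c50, c51, c52, c53, c54]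
  have c70 : c7 0 = 0 := by simp [e7]
  have c71 : c7 1 = 0 := by simp [e7]
  have c72 : c7 2 = 0 := by simp [e7, c60, c61]
  have c73 : c7 3 = 0 := by simp [e7, c60, c62]
  have c74 : c7 4 = 0 := by simp [e7, c60, c61, c62, c63]
  have c75 : c7 5 = 0 := by simp [e7, c60, c61, c63, c64]
  have c76 : c7 6 = 0 := by simp [e7, c60, c61, c62, c64, c65]
  have c77 : c7 7 = c6 6 * A 0 := by simp [e7, c60, c61, c62, c63, c64, c65]
  have c7e : c7 = c7 7 • Cover.e 7 := by
    apply Cover.ext8 <;> simp [c70, c71, c72, c73, c74, c75, c76]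
  rw [c7e, Cover.smul_e7_mem_relIdeal hp] at N
  have cast0 {z : ℤ} (hz : (p : ℤ) ∣ z) : (z : ZMod p) = 0 :=
    (ZMod.intCast_zmod_eq_zero_iff_dvd z p).2 hz
  obtain ⟨⟨i1, j1, f0, f1, f7⟩, f2, f3, f4, f5, f6⟩ := R1
  obtain ⟨⟨i2, j2, g0, g1, g7⟩, -⟩ := R2
  obtain ⟨⟨i3, j3, m0, m1, m7⟩, -⟩ := R3
  obtain ⟨⟨i4, j4, n0, n1, n7⟩, -⟩ := R4
  obtain rfl : i1 = 0 := by simpa [c40, c60, c70, hp.ne_zero] using f0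
  obtain rfl : j1 = 0 := by simpa [c41, c61, c71, hp.ne_zero] using f1
  obtain rfl : i2 = 0 := by simpa [c60, c70, hp.ne_zero] using g0
  obtain rfl : j2 = 0 := by simpa [c61, c71, hp.ne_zero] using g1
  obtain rfl : A 0 = i3 := by simpa [c70, hp.ne_zero] using m0
  obtain rfl : A 1 = j3 := by simpa [c71, hp.ne_zero] using m1
  obtain rfl : B 0 = i4 := by simpa [c70, hp.ne_zero] using n0
  obtain rfl : B 1 = j4 := by simpa [c71, hp.ne_zero] using n1
  have h2 : (2 : ZMod p) ≠ 0 := by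
    intro h
    have := Nat.le_of_dvd two_pos ((ZMod.natCast_eq_zero_iff 2 p).1 (by exact_mod_cast h))
    omega
  have key := coefficients_eq (K := ZMod p) h2 (w := w) (k := k) (l := l) (k' := k') (l' := l')
    (r := A 0) (s := A 1) (t := B 0) (u := B 1) (D := c2 2) (A2 := A 2) (B2 := B 2) (B3 := B 3)
    (c23 := c2 3) (c24 := c2 4) (c25 := c2 5) (c26 := c2 6) hw (by rw [c22]; push_cast; ring) ?_
    (by rw [c23]; push_cast; ring) ?_ ?_ ?_ ?_ ?_ ?_
  · obtain ⟨hr, hs, ht, hu, hl, f, hf⟩ := key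
    replace m7 := cast0 m7
    replace n7 := cast0 n7
    simp only [Cover.sub_apply, Cover.zsmul_apply, c77, c66, c55, c44, c33] at m7 n7
    have hD : ((c2 2 : ℤ) : ZMod p) = A 0 := by
      rw [c22]
      push_cast
      rw [ht, hu]
      ring
    push_cast at m7 n7
    rw [hD, hs, CharP.cast_eq_zero] at m7
    rw [hD, ht, hu, CharP.cast_eq_zero] at n7
    obtain ⟨φ, rfl⟩ := ZMod.intCast_surjective f
    obtain ⟨ε, hε, hεr⟩ : ∃ ε : ℤ, (ε = 1 ∨ ε = -1) ∧ (A 0 : ZMod p) = ε := by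
      rcases mul_self_eq_one_iff.1 ((sq _).symm.trans hr) with h | h
      · exact ⟨1, Or.inl rfl, by simp [h]⟩
      · exact ⟨-1, Or.inr rfl, by simp [h]⟩
    refine ⟨ε, φ, hε, ?_, ?_, ?_, ?_⟩ <;> rw [← ZMod.intCast_eq_intCast_iff] <;> push_cast
    · rw [← hεr]
      exact hf
    · rw [← hεr]
      exact hl
    · rw [← hεr]
      linear_combination (-m' * ((A 0) ^ 4 + (A 0) ^ 2 + 1)) * hr - m7
    · linear_combination (-n' * ((A 0) ^ 4 + (A 0) ^ 2 + 1)) * hr - n7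
  · intro h
    refine N ((ZMod.intCast_zmod_eq_zero_iff_dvd _ p).1 ?_)
    rw [c77, c66, c55, c44, c33]
    push_cast
    linear_combination h
  · have := cast0 f3
    simp only [Cover.sub_apply, Cover.zsmul_apply, Cover.lie3, c20, c43, c63, c73] at this
    push_cast at this
    linear_combination this
  · have := cast0 f4
    simp only [Cover.sub_apply, Cover.zsmul_apply, Cover.lie4, c20, c21, c44, c33, c64, c74] at this
    push_cast at this
    linear_combination this
  · have := cast0 f5
    simp only [Cover.sub_apply, Cover.zsmul_apply, Cover.lie5, c20, c21, c45, c34, c33, c65,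
      c75] at this
    push_cast at this
    linear_combination this
  · have := cast0 f6
    simp only [Cover.sub_apply, Cover.zsmul_apply, Cover.lie6, c20, c21, c46, c35, c34, c66, c55,
      c44,
      c33, c76] at this
    push_cast at this
    linear_combination this
  · have := cast0 f7
    simp only [Cover.sub_apply, Cover.zsmul_apply, Cover.lie7, c20, c21, c47, c36, c35, c34, c33,
      c67, c56, c55,
      c45, c44, c77, c66] at this
    push_cast at this
    linear_combination this
  · have := cast0 g7
    simp only [Cover.sub_apply, Cover.zsmul_apply, Cover.lie7, c40, c41, c42, c43, c46, c45, c35,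
      c34, c33, c67, c56, c55,
      c44, c77, c66] at this
    push_cast at this
    linear_combination this

section Count

variable {p : ℕ}

/-- Indices for the classes of parameters under `ParamRel`. -/
abbrev ParamIndex (p : ℕ) : Type :=
  (Fin (p / 2) × Fin p × Fin p) ⊕ (Fin (p / 2) × Fin p × Fin p) ⊕ (Fin (p / 2) × Fin p) ⊕ Fin p

/-- Representatives of the classes of parameters under `ParamRel`. -/
def ParamIndex.param : ParamIndex p → ℤ × ℤ × ℤ × ℤ
  | .inl (i, m, n) => (0, i + 1, m, n)
  | .inr (.inl (i, m, n)) => (i + 1, 0, m, n)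
  | .inr (.inr (.inl (i, n))) => (0, 0, i + 1, n)
  | .inr (.inr (.inr n)) => (0, 0, 0, n)

lemma card_paramIndex (hodd : Odd p) : Nat.card (ParamIndex p) = p ^ 3 - (p ^ 2 - p) / 2 := by
  obtain ⟨q, rfl⟩ := hodd
  have h1 : (2 * q + 1) / 2 = q := by omega
  have h2 : ((2 * q + 1) ^ 2 - (2 * q + 1)) / 2 = q * (2 * q + 1) := by
    rw [show (2 * q + 1) ^ 2 = 2 * (q * (2 * q + 1)) + (2 * q + 1) by ring]
    omega
  rw [h2]
  simp only [Nat.card_eq_fintype_card, Fintype.card_sum, Fintype.card_prod, Fintype.card_fin, h1]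
  rw [eq_comm, Nat.sub_eq_iff_eq_add] <;> nlinarith [sq_nonneg q]

lemma exists_fin_modEq (hp : 0 < p) (z : ℤ) : ∃ i : Fin p, (i : ℤ) ≡ z [ZMOD p] := by
  have hp' : (0 : ℤ) < p := by exact_mod_cast hp
  have h0 := Int.emod_nonneg z hp'.ne'
  have h1 := Int.emod_lt_of_pos z hp'
  refine ⟨⟨(z % p).toNat, by omega⟩, ?_⟩
  rw [Int.toNat_of_nonneg h0]
  exact Int.mod_modEq z p

lemma exists_half_modEq (hodd : Odd p) {z : ℤ} (hz : ¬ (p : ℤ) ∣ z) :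
    ∃ ε : ℤ, (ε = 1 ∨ ε = -1) ∧ ∃ i : Fin (p / 2), (i + 1 : ℤ) ≡ ε * z [ZMOD p] := by
  obtain ⟨i, hi⟩ := exists_fin_modEq hodd.pos z
  obtain ⟨q, rfl⟩ := hodd
  have hi0 : (i : ℕ) ≠ 0 := fun h ↦ hz (by
    rw [h] at hi
    exact Int.modEq_zero_iff_dvd.1 hi.symm)
  have hlt := i.2
  rcases le_or_gt (i : ℕ) q with h | h
  · refine ⟨1, .inl rfl, ⟨i - 1, by omega⟩, ?_⟩
    rw [one_mul]
    convert hi using 1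
    push_cast [Nat.one_le_iff_ne_zero.2 hi0]
    ring
  · refine ⟨-1, .inr rfl, ⟨2 * q - i, by omega⟩, ?_⟩
    refine Int.ModEq.trans ?_ (hi.mul_left (-1))
    refine (Int.modEq_iff_dvd.2 ⟨-1, ?_⟩)
    push_cast [show (i : ℕ) ≤ 2 * q by omega]
    ring

lemma fin_eq_of_modEq {i j : Fin p} (h : (i : ℤ) ≡ j [ZMOD p]) : j = i := by
  have hi := i.2
  have hj := j.2
  exact Fin.ext (Nat.ModEq.eq_of_lt_of_lt (Int.natCast_modEq_iff.1 h.symm) hj hi)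

lemma half_eq_of_modEq (hodd : Odd p) {i j : Fin (p / 2)} {ε : ℤ} (hε : ε = 1 ∨ ε = -1)
    (h : (i + 1 : ℤ) ≡ ε * (j + 1) [ZMOD p]) : j = i ∧ ε = 1 := by
  obtain ⟨q, rfl⟩ := hodd
  have hi := i.2
  have hj := j.2
  obtain ⟨c, hc⟩ := Int.modEq_iff_dvd.1 h
  have hq : 0 ≤ (q : ℤ) := by omega
  push_cast at hc
  have hiq : ((i : ℕ) : ℤ) + 1 ≤ q := by omega
  have hjq : ((j : ℕ) : ℤ) + 1 ≤ q := by omega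
  have hi0 : (0 : ℤ) ≤ (i : ℕ) := by omega
  have hj0 : (0 : ℤ) ≤ (j : ℕ) := by omega
  rcases hε with rfl | rfl
  · have hc1 : c < 1 := by nlinarith
    have hc2 : -1 < c := by nlinarith
    obtain rfl : c = 0 := by omega
    exact ⟨Fin.ext (by omega), rfl⟩
  · have hc1 : c < 0 := by nlinarith
    have hc2 : -1 < c := by nlinarith
    omega

lemma not_half_modEq_zero (i : Fin (p / 2)) : ¬ ((i + 1 : ℤ) ≡ 0 [ZMOD p]) := fun h ↦ by
  have hi := i.2
  have := Int.le_of_dvd (by omega) (Int.modEq_zero_iff_dvd.1 h)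
  omega

lemma not_zero_modEq_half {i : Fin (p / 2)} {ε : ℤ} (hε : ε = 1 ∨ ε = -1) :
    ¬ (0 ≡ ε * (i + 1) [ZMOD p]) := fun h ↦ by
  refine not_half_modEq_zero i ?_
  have := (h.mul_left ε).symm
  rcases hε with rfl | rfl <;> simpa using this

lemma exists_paramRel_param (hp : p.Prime) (hodd : Odd p) (k l m n : ℤ) :
    ∃ t : ParamIndex p, ParamRel p k l m n t.param.1 t.param.2.1 t.param.2.2.1 t.param.2.2.2 := by
  have : Fact p.Prime := ⟨hp⟩
  have hfin := exists_fin_modEq hp.pos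
  obtain ⟨n', hn⟩ := hfin n
  by_cases hl : (p : ℤ) ∣ l
  · have hl0 : l ≡ 0 [ZMOD p] := Int.modEq_zero_iff_dvd.2 hl
    have hl1 (ε : ℤ) : 0 ≡ ε * l [ZMOD p] := by simpa using (hl0.mul_left ε).symm
    by_cases hk : (p : ℤ) ∣ k
    · have hk1 (ε : ℤ) : 0 ≡ ε * k + 0 * l [ZMOD p] := by
        simpa using ((Int.modEq_zero_iff_dvd.2 hk).mul_left ε).symm
      by_cases hm : (p : ℤ) ∣ m
      · exact ⟨.inr (.inr (.inr n')), 1, 0, .inl rfl, hk1 1, hl1 1,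
          by simpa [ParamIndex.param] using (Int.modEq_zero_iff_dvd.2 hm).symm, hn⟩
      · obtain ⟨ε, hε, i, hi⟩ := exists_half_modEq hodd hm
        exact ⟨.inr (.inr (.inl (i, n'))), ε, 0, hε, hk1 ε, hl1 ε, hi, hn⟩
    · obtain ⟨ε, hε, i, hi⟩ := exists_half_modEq hodd hk
      obtain ⟨m', hm⟩ := hfin (ε * m)
      exact ⟨.inr (.inl (i, m', n')), ε, 0, hε, by simpa [ParamIndex.param] using hi, hl1 ε, hm, hn⟩
  · obtain ⟨ε, hε, i, hi⟩ := exists_half_modEq hodd hl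
    obtain ⟨m', hm⟩ := hfin (ε * m)
    obtain ⟨f, hf⟩ := ZMod.intCast_surjective (-(ε * k) / l : ZMod p)
    refine ⟨.inl (i, m', n'), ε, f, hε, ?_, hi, hm, hn⟩
    rw [← ZMod.intCast_eq_intCast_iff]
    have hl' : (l : ZMod p) ≠ 0 := by rwa [Ne, ZMod.intCast_zmod_eq_zero_iff_dvd]
    simp [ParamIndex.param, hf, hl']

lemma ParamIndex.eq_of_paramRel (hodd : Odd p) {s t : ParamIndex p}
    (h : ParamRel p s.param.1 s.param.2.1 s.param.2.2.1 s.param.2.2.2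
      t.param.1 t.param.2.1 t.param.2.2.1 t.param.2.2.2) : s = t := by
  obtain ⟨ε, f, hε, h1, h2, h3, h4⟩ := h
  rcases s with ⟨i, m, n⟩ | ⟨i, m, n⟩ | ⟨i, n⟩ | n <;>
  rcases t with ⟨i', m', n'⟩ | ⟨i', m', n'⟩ | ⟨i', n'⟩ | n' <;>
  simp only [ParamIndex.param, mul_zero, add_zero, zero_add] at h1 h2 h3 h4 <;>
  first
  | exact absurd h1 (not_half_modEq_zero _)
  | exact absurd h2 (not_half_modEq_zero _)
  | exact absurd h3 (not_half_modEq_zero _)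
  | exact absurd h1 (not_zero_modEq_half hε)
  | exact absurd h2 (not_zero_modEq_half hε)
  | exact absurd h3 (not_zero_modEq_half hε)
  | skip
  · obtain ⟨rfl, rfl⟩ := half_eq_of_modEq hodd hε h2
    rw [one_mul] at h3
    rw [fin_eq_of_modEq h3, fin_eq_of_modEq h4]
  · obtain ⟨rfl, rfl⟩ := half_eq_of_modEq hodd hε h1
    rw [one_mul] at h3
    rw [fin_eq_of_modEq h3, fin_eq_of_modEq h4]
  · obtain ⟨rfl, rfl⟩ := half_eq_of_modEq hodd hε h3
    rw [fin_eq_of_modEq h4]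
  · rw [fin_eq_of_modEq h4]

end Count

lemma IsLieIso.refl (A : Type*) [LieRing A] : IsLieIso A A :=
  ⟨Equiv.refl A, fun _ _ ↦ rfl, fun _ _ ↦ rfl⟩

lemma IsLieIso.symm {A B : Type*} [LieRing A] [LieRing B] (h : IsLieIso A B) : IsLieIso B A := by
  obtain ⟨e, h1, h2⟩ := h
  exact ⟨e.symm, fun x y ↦ e.injective (by simp [h1]), fun x y ↦ e.injective (by simp [h2])⟩

lemma IsLieIso.trans {A B C : Type*} [LieRing A] [LieRing B] [LieRing C] (h : IsLieIso A B)
    (h' : IsLieIso B C) : IsLieIso A C := by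
  obtain ⟨e, h1, h2⟩ := h
  obtain ⟨f, h3, h4⟩ := h'
  exact ⟨e.trans f, fun x y ↦ by simp [h1, h3], fun x y ↦ by simp [h2, h4]⟩

lemma exists_lieRing_isLieIso {α β : Type*} [LieRing β] (e : α ≃ β) :
    ∃ s : LieRing α, @IsLieIso β α _ s := by
  let := e.lieRing
  exact ⟨e.lieRing, e.symm,
    fun x y ↦ e.injective (by simp [Equiv.add_def]),
    fun x y ↦ e.injective (by simp [e.bracket_def])⟩

/-- The Lie ring 7.657 : `⟨a,b | [b,a,b]-[b,a,a,a]-w[b,a,a,a,a,a],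
[b,a,a,a,b]-[b,a,a,a,a,a], pa, pb, class 6⟩`, where `w` is a primitive root mod `p`
(i.e. the residue of `w` in `ZMod p` has multiplicative order `p-1`), has
`p³ - (p² - p)/2` descendants of order `p^8` (of maximal class 7). -/
theorem descendants_of_7_657 (p : ℕ) (hp : p.Prime) (h5 : 5 ≤ p)
    (w : ℤ) (hw : orderOf (w : ZMod p) = p - 1) :
    Nat.card (Quot (fun s t :
        {s : LieRing (Fin (p ^ 8)) //
          IsMaxClassDescendantOf p (presLie p {bab - ba3 - w • ba5, ba3b - ba5}) s} =>
      @IsLieIso _ _ s.1 t.1)) = p ^ 3 - (p ^ 2 - p) / 2 := by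
  have : Fact p.Prime := ⟨hp⟩
  have hodd : Odd p := hp.odd_of_ne_two (by omega)
  have hw0 : (w : ZMod p) ≠ 0 := fun h ↦ by
    rw [h, orderOf_zero] at hw
    omega
  have hcard : Nat.card (Fin (p ^ 8)) = p ^ 8 := Nat.card_fin _
  have hex (t : ParamIndex p) : ∃ s : {s : LieRing (Fin (p ^ 8)) //
      IsMaxClassDescendantOf p (presLie p (relators w)) s},
      @IsPres p w t.param.1 t.param.2.1 t.param.2.2.1 t.param.2.2.2 (Fin (p ^ 8)) s.1 := by
    have hc := Cover.card_quotient_relIdeal (w := w) (k := t.param.1) (l := t.param.2.1)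
      (m := t.param.2.2.1) (n := t.param.2.2.2) hp
    have := Nat.finite_of_card_ne_zero (hc.trans_ne (pow_ne_zero 8 hp.ne_zero))
    obtain ⟨s, hs⟩ := exists_lieRing_isLieIso (Finite.equivFinOfCardEq hc).symm
    have h := isPres_quotient.of_isLieIso hs
    exact ⟨⟨s, h.lieClassEq hp, h.isLieIso_quotient hodd⟩, h⟩
  choose F hF using hex
  rw [← card_paramIndex hodd]
  refine (Nat.card_eq_of_bijective (fun t ↦ Quot.mk _ (F t)) ⟨fun t t' h ↦ ?_, fun c ↦ ?_⟩).symm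
  · have hequiv : Equivalence (fun s t : {s : LieRing (Fin (p ^ 8)) //
        IsMaxClassDescendantOf p (presLie p (relators w)) s} => @IsLieIso _ _ s.1 t.1) :=
      ⟨fun s ↦ @IsLieIso.refl _ s.1, fun {s t} h ↦ @IsLieIso.symm _ _ s.1 t.1 h,
        fun {s t u} h h' ↦ @IsLieIso.trans _ _ _ s.1 t.1 u.1 h h'⟩
    have hiso : @IsLieIso _ _ (F t).1 (F t').1 := hequiv.eqvGen_iff.1 (Quot.eqvGen_exact h)
    let := (F t').1
    have h' := (@IsPres.of_isLieIso _ _ _ _ _ _ _ (F t).1 _ (F t').1 (hF t) hiso)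
    exact ParamIndex.eq_of_paramRel hodd (h'.paramRel hp h5 hw0 (hF t'))
  · obtain ⟨⟨s, hs⟩, rfl⟩ := Quot.exists_rep c
    let := s
    obtain ⟨k, l, m, n, h⟩ := exists_isPres hp hodd w hcard hs.1 hs.2
    obtain ⟨t, ht⟩ := exists_paramRel_param hp hodd k l m n
    refine ⟨t, Quot.sound ?_⟩
    exact @IsPres.isLieIso _ _ _ _ _ _ _ (F t).1 _ s (hF t) (h.of_paramRel hp hodd hcard ht)
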